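/- arXiv:1607.01324 — 2 statements merged into one kernel-verified Lean document; each statement's English description precedes it below -/
import Mathlib

section
/- Let (Λ, ξ) be a decorated D-lattice of dimension N (Λ ≅ U² ⊕ D_{N-2}, ξ ∈ A_Λ with q(ξ) ≡ 1 mod 2ℤ), and let v ∈ Λ be a hyperelliptic vector, i.e., v² = -4 and div(v) = 2 with v* = ξ. Then v^⊥ ⊂ Λ is isomorphic to Λ_{N-1} = U² ⊕ D_{N-3}, i.e., v^⊥ is a dimension-(N-1) D-lattice. -/
noncomputable section

open scoped BigOperators

/-- `x` has integer entries. -/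
def IntVec {n : ℕ} (x : Fin n → ℚ) : Prop := ∀ i, ∃ a : ℤ, x i = (a : ℚ)

/-- The lattice `D_n = {x ∈ ℤⁿ : Σ xᵢ ≡ 0 mod 2}` (viewed inside `ℚⁿ`),
equipped with the negative of the Euclidean form `negE`. -/
def DSet (n : ℕ) : Set (Fin n → ℚ) :=
  {x | IntVec x ∧ ∃ a : ℤ, (∑ i, x i) = 2 * (a : ℚ)}

/-- The negative of the standard Euclidean bilinear form. -/
def negE {n : ℕ} (x y : Fin n → ℚ) : ℚ := - ∑ i, x i * y i

/-- The vector `(1/2, …, 1/2)`. -/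
def halfVec (n : ℕ) : Fin n → ℚ := fun _ => 1/2

/-- The lattice `Λ_N = U² ⊕ D_{N-2}` realized inside `ℚ^{N+2}`: integral vectors whose
coordinates of index `≥ 4` have even sum.  The first four coordinates carry the two
hyperbolic planes. -/
def LamSet (N : ℕ) : Set (Fin (N + 2) → ℚ) :=
  {x | IntVec x ∧ ∃ a : ℤ, (∑ i : Fin (N + 2), if 4 ≤ (i : ℕ) then x i else 0) = 2 * (a : ℚ)}

/-- The bilinear form of `Λ_N = U² ⊕ D_{N-2}`. -/
def LamForm (N : ℕ) (x y : Fin (N + 2) → ℚ) : ℚ :=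
  x 0 * y 1 + x 1 * y 0 + x 2 * y 3 + x 3 * y 2
    - ∑ i : Fin (N + 2), (if 4 ≤ (i : ℕ) then x i * y i else 0)

/-- The (negative definite) `E₈` lattice inside `ℚ⁸`: vectors that are integral or
half-integral, with even coordinate sum; the form is `negE`. -/
def E8Set : Set (Fin 8 → ℚ) :=
  {x | (IntVec x ∨ IntVec (x - halfVec 8)) ∧ ∃ a : ℤ, (∑ i, x i) = 2 * (a : ℚ)}

/-- Ambient space for the even unimodular lattice `II_{2,2+8k} = U² ⊕ E₈^k`. -/
abbrev IIAmb (k : ℕ) := (Fin 4 → ℚ) × (Fin k → Fin 8 → ℚ)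

/-- The form of `U²` on `ℚ⁴`. -/
def UForm (x y : Fin 4 → ℚ) : ℚ := x 0 * y 1 + x 1 * y 0 + x 2 * y 3 + x 3 * y 2

/-- The bilinear form of `II_{2,2+8k} = U² ⊕ E₈^k`. -/
def IIForm (k : ℕ) (x y : IIAmb k) : ℚ := UForm x.1 y.1 + ∑ j, negE (x.2 j) (y.2 j)

/-- The even unimodular lattice `II_{2,2+8k} = U² ⊕ E₈^k` inside its ambient space. -/
def IISet (k : ℕ) : Set (IIAmb k) := {p | IntVec p.1 ∧ ∀ j, p.2 j ∈ E8Set}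

/-- `v` has divisibility `d` in `Λ_N`: all pairings with lattice vectors are divisible
by `d`, and `d` is attained. -/
def HasDiv (N : ℕ) (v : Fin (N + 2) → ℚ) (d : ℤ) : Prop :=
  (∀ x ∈ LamSet N, ∃ a : ℤ, LamForm N v x = (d : ℚ) * a) ∧
  ∃ x ∈ LamSet N, LamForm N v x = (d : ℚ)

/-- `ξ` represents a decoration of `Λ_N`: an element of the dual lattice whose class in
the discriminant group has square `1` modulo `2ℤ`. -/
def IsDeco (N : ℕ) (ξ : Fin (N + 2) → ℚ) : Prop :=
  (∀ y ∈ LamSet N, ∃ a : ℤ, LamForm N ξ y = (a : ℚ)) ∧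
  ∃ a : ℤ, LamForm N ξ ξ = 1 + 2 * (a : ℚ)

set_option linter.unusedSimpArgs false

abbrev VV (N : ℕ) := Fin (N + 2) → ℚ

lemma LF_comm (N : ℕ) (x y : VV N) : LamForm N x y = LamForm N y x := by
  unfold LamForm
  have : ∀ i : Fin (N+2), (if 4 ≤ (i : ℕ) then x i * y i else 0)
      = (if 4 ≤ (i : ℕ) then y i * x i else 0) := by
    intro i; rw [mul_comm]
  simp only [this]; ring

lemma LF_add_left (N : ℕ) (x y z : VV N) :
    LamForm N (x + y) z = LamForm N x z + LamForm N y z := by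
  unfold LamForm
  have : ∀ i : Fin (N+2), (if 4 ≤ (i : ℕ) then (x + y) i * z i else 0)
      = (if 4 ≤ (i : ℕ) then x i * z i else 0) + (if 4 ≤ (i : ℕ) then y i * z i else 0) := by
    intro i; split_ifs <;> simp [add_mul]
  rw [Finset.sum_congr rfl (fun i _ => this i), Finset.sum_add_distrib]
  simp only [Pi.add_apply]; ring

lemma LF_smul_left (N : ℕ) (c : ℚ) (x z : VV N) :
    LamForm N (c • x) z = c * LamForm N x z := by
  unfold LamForm
  have : ∀ i : Fin (N+2), (if 4 ≤ (i : ℕ) then (c • x) i * z i else 0)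
      = c * (if 4 ≤ (i : ℕ) then x i * z i else 0) := by
    intro i; split_ifs <;> simp [mul_assoc]
  rw [Finset.sum_congr rfl (fun i _ => this i), ← Finset.mul_sum]
  simp only [Pi.smul_apply, smul_eq_mul]; ring

lemma LF_add_right (N : ℕ) (x y z : VV N) :
    LamForm N z (x + y) = LamForm N z x + LamForm N z y := by
  rw [LF_comm, LF_add_left, LF_comm N x, LF_comm N y]

lemma LF_smul_right (N : ℕ) (c : ℚ) (x z : VV N) :
    LamForm N z (c • x) = c * LamForm N z x := by
  rw [LF_comm, LF_smul_left, LF_comm N x]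

lemma LF_sub_left (N : ℕ) (x y z : VV N) :
    LamForm N (x - y) z = LamForm N x z - LamForm N y z := by
  have : x - y = x + (-1 : ℚ) • y := by simp [sub_eq_add_neg]
  rw [this, LF_add_left, LF_smul_left]; ring

lemma LF_sub_right (N : ℕ) (x y z : VV N) :
    LamForm N z (x - y) = LamForm N z x - LamForm N z y := by
  rw [LF_comm, LF_sub_left, LF_comm N x, LF_comm N y]

lemma LF_neg_left (N : ℕ) (x z : VV N) : LamForm N (-x) z = - LamForm N x z := by
  rw [← neg_one_smul ℚ x, LF_smul_left]; ring

lemma LF_neg_right (N : ℕ) (x z : VV N) : LamForm N z (-x) = - LamForm N z x := by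
  rw [LF_comm, LF_neg_left, LF_comm N x]

def LB (N : ℕ) : VV N →ₗ[ℚ] VV N →ₗ[ℚ] ℚ :=
  LinearMap.mk₂ ℚ (LamForm N) (LF_add_left N) (LF_smul_left N)
    (fun m n1 n2 => LF_add_right N n1 n2 m) (fun c m n => LF_smul_right N c n m)

lemma LB_apply (N : ℕ) (x y : VV N) : LB N x y = LamForm N x y := rfl

/-- Eichler transvection. -/
def tr (N : ℕ) (e x : VV N) : VV N →ₗ[ℚ] VV N :=
  LinearMap.id - (LB N x).smulRight e + (LB N e).smulRight x
    - (LB N e).smulRight ((LamForm N x x / 2) • e)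

lemma tr_apply (N : ℕ) (e x y : VV N) : tr N e x y =
    y - LamForm N x y • e + LamForm N e y • x - (LamForm N e y * (LamForm N x x / 2)) • e := by
  simp [tr, LB_apply, smul_smul]

lemma tr_form (N : ℕ) (e x : VV N) (he : LamForm N e e = 0) (hx : LamForm N e x = 0) (y z : VV N) :
    LamForm N (tr N e x y) (tr N e x z) = LamForm N y z := by
  have hx' : LamForm N x e = 0 := by rw [LF_comm, hx]
  simp only [tr_apply, LF_add_left, LF_add_right, LF_sub_left, LF_sub_right, LF_smul_left,
    LF_smul_right, he, hx, hx']
  rw [LF_comm N y e, LF_comm N y x]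
  ring

lemma tr_inv (N : ℕ) (e x : VV N) (he : LamForm N e e = 0) (hx : LamForm N e x = 0) (y : VV N) :
    tr N e (-x) (tr N e x y) = y := by
  have hx' : LamForm N x e = 0 := by rw [LF_comm, hx]
  simp only [tr_apply, LF_add_left, LF_add_right, LF_sub_left, LF_sub_right, LF_smul_left,
    LF_smul_right, he, hx, hx', LF_neg_left, LF_neg_right]
  ext i
  simp only [Pi.add_apply, Pi.sub_apply, Pi.smul_apply, Pi.neg_apply, smul_eq_mul]
  ring

def trE (N : ℕ) (e x : VV N) (he : LamForm N e e = 0) (hx : LamForm N e x = 0) :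
    VV N ≃ₗ[ℚ] VV N :=
  LinearEquiv.ofLinearMap (tr N e x) (tr N e (-x))
    (by
      ext1 i
      apply LinearMap.ext; intro c
      have := tr_inv N e (-x) he (by rw [LF_neg_right, hx, neg_zero]) (Pi.single i c)
      simpa using this)
    (by
      ext1 i
      apply LinearMap.ext; intro c
      simpa using tr_inv N e x he hx (Pi.single i c))

lemma trE_apply (N : ℕ) (e x : VV N) (he : LamForm N e e = 0) (hx : LamForm N e x = 0) (y : VV N) :
    trE N e x he hx y = tr N e x y := rfl

lemma trE_symm_apply (N : ℕ) (e x : VV N) (he : LamForm N e e = 0) (hx : LamForm N e x = 0)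
    (y : VV N) : (trE N e x he hx).symm y = tr N e (-x) y := rfl

/-! integrality -/

lemma IV_add {n : ℕ} {x y : Fin n → ℚ} (hx : IntVec x) (hy : IntVec y) : IntVec (x + y) := by
  intro i
  obtain ⟨a, ha⟩ := hx i
  obtain ⟨b, hb⟩ := hy i
  exact ⟨a + b, by simp [ha, hb]⟩

lemma IV_smul {n : ℕ} {x : Fin n → ℚ} (k : ℤ) (hx : IntVec x) : IntVec ((k : ℚ) • x) := by
  intro i
  obtain ⟨a, ha⟩ := hx i
  exact ⟨k * a, by simp [ha]⟩

def tsum4 (N : ℕ) (x : VV N) : ℚ := ∑ i : Fin (N + 2), if 4 ≤ (i : ℕ) then x i else 0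

lemma tsum4_add (N : ℕ) (x y : VV N) : tsum4 N (x + y) = tsum4 N x + tsum4 N y := by
  unfold tsum4
  rw [← Finset.sum_add_distrib]
  apply Finset.sum_congr rfl
  intro i _; split_ifs <;> simp

lemma tsum4_smul (N : ℕ) (c : ℚ) (x : VV N) : tsum4 N (c • x) = c * tsum4 N x := by
  unfold tsum4
  rw [Finset.mul_sum]
  apply Finset.sum_congr rfl
  intro i _; split_ifs <;> simp

lemma mem_Lam (N : ℕ) (x : VV N) :
    x ∈ LamSet N ↔ IntVec x ∧ ∃ a : ℤ, tsum4 N x = 2 * (a : ℚ) := Iff.rfl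

lemma Lam_add {N : ℕ} {x y : VV N} (hx : x ∈ LamSet N) (hy : y ∈ LamSet N) : x + y ∈ LamSet N := by
  rw [mem_Lam] at *
  obtain ⟨hx, a, ha⟩ := hx
  obtain ⟨hy, b, hb⟩ := hy
  exact ⟨IV_add hx hy, a + b, by rw [tsum4_add, ha, hb]; push_cast; ring⟩

lemma Lam_smul {N : ℕ} {x : VV N} (k : ℤ) (hx : x ∈ LamSet N) : (k : ℚ) • x ∈ LamSet N := by
  rw [mem_Lam] at *
  obtain ⟨hx, a, ha⟩ := hx
  exact ⟨IV_smul k hx, k * a, by rw [tsum4_smul, ha]; push_cast; ring⟩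

lemma Lam_neg {N : ℕ} {x : VV N} (hx : x ∈ LamSet N) : -x ∈ LamSet N := by
  have := Lam_smul (-1) hx
  simpa using this

lemma Lam_sub {N : ℕ} {x y : VV N} (hx : x ∈ LamSet N) (hy : y ∈ LamSet N) : x - y ∈ LamSet N := by
  rw [sub_eq_add_neg]; exact Lam_add hx (Lam_neg hy)

lemma LF_int {N : ℕ} {x y : VV N} (hx : IntVec x) (hy : IntVec y) :
    ∃ a : ℤ, LamForm N x y = a := by
  choose p hp using hx
  choose q hq using hy
  refine ⟨p 0 * q 1 + p 1 * q 0 + p 2 * q 3 + p 3 * q 2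
    - ∑ i : Fin (N + 2), (if 4 ≤ (i : ℕ) then p i * q i else 0), ?_⟩
  unfold LamForm
  push_cast
  simp only [hp, hq]

lemma LF_par {N : ℕ} {x : VV N} (hx : IntVec x) :
    ∃ a : ℤ, LamForm N x x = tsum4 N x + 2 * a := by
  choose p hp using hx
  have h2 : ∀ i, ∃ t : ℤ, p i * p i = p i + 2 * t := by
    intro i
    obtain ⟨t, ht⟩ := (Int.even_mul_succ_self (p i - 1))
    exact ⟨t, by linarith⟩
  choose t ht using h2
  refine ⟨p 0 * p 1 + p 2 * p 3 - (∑ i : Fin (N + 2), (if 4 ≤ (i : ℕ) then p i else 0))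
    - ∑ i : Fin (N + 2), (if 4 ≤ (i : ℕ) then t i else 0), ?_⟩
  have : ∀ i : Fin (N+2), (if 4 ≤ (i : ℕ) then x i * x i else 0)
      = (if 4 ≤ (i : ℕ) then (p i : ℚ) else 0) + 2 * (if 4 ≤ (i : ℕ) then (t i : ℚ) else 0) := by
    intro i; split_ifs
    · rw [hp]; exact_mod_cast ht i
    · simp
  unfold LamForm tsum4
  simp only [this, Finset.sum_add_distrib, ← Finset.mul_sum]
  push_cast
  simp only [hp]
  ring

lemma tr_int {N : ℕ} {e x y : VV N} (he : e ∈ LamSet N) (hx : x ∈ LamSet N) (hy : IntVec y) :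
    ∃ d ∈ LamSet N, tr N e x y = y + d := by
  obtain ⟨a, ha⟩ := LF_int hx.1 hy
  obtain ⟨b, hb⟩ := LF_int he.1 hy
  obtain ⟨c, hc⟩ := LF_par hx.1
  obtain ⟨c', hc'⟩ := ((mem_Lam N x).1 hx).2
  refine ⟨((-a : ℤ) : ℚ) • e + (b : ℚ) • x + ((-(b * (c + c')) : ℤ) : ℚ) • e,
    Lam_add (Lam_add (Lam_smul _ he) (Lam_smul _ hx)) (Lam_smul _ he), ?_⟩
  rw [tr_apply, ha, hb, hc, hc']
  ext i
  simp only [Pi.add_apply, Pi.sub_apply, Pi.smul_apply, smul_eq_mul]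
  push_cast
  ring

def IsIso (N : ℕ) (g : VV N ≃ₗ[ℚ] VV N) : Prop :=
  (∀ x y, LamForm N (g x) (g y) = LamForm N x y) ∧ ∀ x, g x ∈ LamSet N ↔ x ∈ LamSet N

def RR (N : ℕ) (x y : VV N) : Prop := ∃ g, IsIso N g ∧ g x = y

lemma RR_refl (N : ℕ) (x : VV N) : RR N x x :=
  ⟨LinearEquiv.refl ℚ _, ⟨fun _ _ => rfl, fun _ => Iff.rfl⟩, rfl⟩

lemma RR_trans {N : ℕ} {x y z : VV N} (h : RR N x y) (h' : RR N y z) : RR N x z := by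
  obtain ⟨g, hg, rfl⟩ := h
  obtain ⟨k, hk, rfl⟩ := h'
  refine ⟨g.trans k, ⟨fun a b => ?_, fun a => ?_⟩, rfl⟩
  · simp [hk.1, hg.1]
  · simp [hk.2, hg.2]

lemma RR_tr {N : ℕ} {e x : VV N} (he : e ∈ LamSet N) (hx : x ∈ LamSet N)
    (hee : LamForm N e e = 0) (hex : LamForm N e x = 0) (y : VV N) : RR N y (tr N e x y) := by
  refine ⟨trE N e x hee hex, ⟨fun a b => tr_form N e x hee hex a b, fun a => ?_⟩, rfl⟩
  have key : ∀ x ∈ LamSet N, ∀ a ∈ LamSet N, tr N e x a ∈ LamSet N := by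
    intro x hx a ha
    obtain ⟨d, hd, h⟩ := tr_int he hx ha.1
    rw [h]; exact Lam_add ha hd
  constructor
  · intro h
    have := key (-x) (Lam_neg hx) _ h
    rwa [trE_apply, tr_inv N e x hee hex] at this
  · exact key x hx a

/-- orbit of integral vectors -/
def OO (N : ℕ) (w y : VV N) : Prop := RR N w y ∧ IntVec y

lemma OO_tr {N : ℕ} {e x : VV N} (he : e ∈ LamSet N) (hx : x ∈ LamSet N)
    (hee : LamForm N e e = 0) (hex : LamForm N e x = 0) {w y : VV N} (h : OO N w y) :
    OO N w (tr N e x y) := by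
  refine ⟨RR_trans h.1 (RR_tr he hx hee hex y), ?_⟩
  obtain ⟨d, hd, h'⟩ := tr_int he hx h.2
  rw [h']; exact IV_add h.2 hd.1

set_option linter.unusedSimpArgs false

section nums
variable (M : ℕ)

lemma fv0 : ((0 : Fin (M+4+2)) : ℕ) = 0 := rfl
lemma fv1 : ((1 : Fin (M+4+2)) : ℕ) = 1 := rfl
@[simp] lemma md2 : 2 % (M+4+2) = 2 := Nat.mod_eq_of_lt (by omega)
lemma fv2 : ((2 : Fin (M+4+2)) : ℕ) = 2 := by simp
@[simp] lemma md3 : 3 % (M+4+2) = 3 := Nat.mod_eq_of_lt (by omega)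
lemma fv3 : ((3 : Fin (M+4+2)) : ℕ) = 3 := by simp
@[simp] lemma md4 : 4 % (M+4+2) = 4 := Nat.mod_eq_of_lt (by omega)
lemma fv4 : ((4 : Fin (M+4+2)) : ℕ) = 4 := by simp
@[simp] lemma md5 : 5 % (M+4+2) = 5 := Nat.mod_eq_of_lt (by omega)
lemma fv5 : ((5 : Fin (M+4+2)) : ℕ) = 5 := by simp

end nums

/-- basis vectors -/
def EE (M : ℕ) (i : Fin (M+4+2)) : VV (M+4) := fun j => if (j : ℕ) = (i : ℕ) then 1 else 0

lemma EE_int (M : ℕ) (i) : IntVec (EE M i) := by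
  intro j
  unfold EE
  split_ifs
  · exact ⟨1, by simp⟩
  · exact ⟨0, by simp⟩

lemma tsum4_EE (M : ℕ) (i) : tsum4 (M+4) (EE M i) = if 4 ≤ (i : ℕ) then 1 else 0 := by
  unfold tsum4 EE
  have : ∀ j : Fin (M+4+2), (if 4 ≤ (j : ℕ) then (if (j : ℕ) = (i : ℕ) then (1 : ℚ) else 0) else 0)
     = if j = i then (if 4 ≤ (i : ℕ) then 1 else 0) else 0 := by
    intro j
    by_cases h : j = i
    · subst h; simp
    · have : (j : ℕ) ≠ i := fun h' => h (Fin.ext h')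
      simp [h, this]
  rw [Finset.sum_congr rfl (fun i _ => this i)]
  simp

lemma EE_Lam (M : ℕ) (i : Fin (M+4+2)) (h : (i : ℕ) < 4) : EE M i ∈ LamSet (M+4) := by
  rw [mem_Lam]
  refine ⟨EE_int M i, 0, ?_⟩
  rw [tsum4_EE, if_neg (by omega)]; simp

lemma sum_EE (M : ℕ) (i) (y : VV (M+4)) :
    (∑ j : Fin (M+4+2), (if 4 ≤ (j : ℕ) then EE M i j * y j else 0))
      = if 4 ≤ (i : ℕ) then y i else 0 := by
  unfold EE
  have : ∀ j : Fin (M+4+2), (if 4 ≤ (j : ℕ) then (if (j : ℕ) = (i : ℕ) then (1 : ℚ) else 0) * y j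
     else 0) = if j = i then (if 4 ≤ (i : ℕ) then y i else 0) else 0 := by
    intro j
    by_cases h : j = i
    · subst h; simp
    · have : (j : ℕ) ≠ i := fun h' => h (Fin.ext h')
      simp [h, this]
  rw [Finset.sum_congr rfl (fun i _ => this i)]
  simp

lemma LF_E0 (M : ℕ) (y : VV (M+4)) : LamForm (M+4) (EE M 0) y = y 1 := by
  unfold LamForm; rw [sum_EE]; simp [EE, fv0, fv1, fv2, fv3]
lemma LF_E1 (M : ℕ) (y : VV (M+4)) : LamForm (M+4) (EE M 1) y = y 0 := by
  unfold LamForm; rw [sum_EE]; simp [EE, fv0, fv1, fv2, fv3]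
lemma LF_E2 (M : ℕ) (y : VV (M+4)) : LamForm (M+4) (EE M 2) y = y 3 := by
  unfold LamForm; rw [sum_EE]; simp [EE, fv0, fv1, fv2, fv3]
lemma LF_E3 (M : ℕ) (y : VV (M+4)) : LamForm (M+4) (EE M 3) y = y 2 := by
  unfold LamForm; rw [sum_EE]; simp [EE, fv0, fv1, fv2, fv3]
lemma LF_Ege (M : ℕ) (i : Fin (M+4+2)) (hi : 4 ≤ (i : ℕ)) (y : VV (M+4)) :
    LamForm (M+4) (EE M i) y = - y i := by
  have h0 : (0 : ℕ) ≠ i := by omega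
  have h1 : (1 : ℕ) ≠ i := by omega
  have h2 : (2 : ℕ) ≠ i := by omega
  have h3 : (3 : ℕ) ≠ i := by omega
  unfold LamForm; rw [sum_EE]
  simp [EE, fv1, fv2, fv3, hi, h0, h1, h2, h3]

lemma euclid (a c : ℤ) (_ha : a ≠ 0) (hr : c % a ≠ 0) :
    ∃ k : ℤ, a - k * (c % a) ≠ 0 ∧ |a - k * (c % a)| < |a| := by
  have h1 := Int.emod_nonneg c _ha
  have h2 := Int.emod_lt_abs c _ha
  set r := c % a
  have hr' : 0 < r := lt_of_le_of_ne h1 (Ne.symm hr)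
  refine ⟨(a - 1) / r, ?_⟩
  have h3 := Int.emod_add_mul_ediv (a-1) r
  have h4 := Int.emod_nonneg (a-1) hr
  have h5 := Int.emod_lt_of_pos (a-1) hr'
  have h6 : a - (a-1)/r * r = (a-1) % r + 1 := by linarith [mul_comm r ((a-1)/r)]
  rw [h6]
  refine ⟨by omega, ?_⟩
  rw [abs_of_pos (by omega)]; omega

def MinA (M : ℕ) (w : VV (M+4)) (a : ℤ) : Prop :=
  ∀ (z : VV (M+4)) (b : ℤ), OO (M+4) w z → z 0 = b → b ≠ 0 → |a| ≤ |b|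

lemma dvd2 (M : ℕ) {w y : VV (M+4)} {a c : ℤ} (hmin : MinA M w a) (hy : OO (M+4) w y)
    (ha : a ≠ 0) (hya : y 0 = a) (hyc : y 2 = c) : a ∣ c := by
  by_contra hn
  have hr : c % a ≠ 0 := fun h => hn (Int.dvd_of_emod_eq_zero h)
  obtain ⟨k, hk0, hk⟩ := euclid a c ha hr
  have h1 := OO_tr (EE_Lam M 2 (by simp [fv2])) (Lam_smul (c / a) (EE_Lam M 1 (by simp [fv1])))
    (by rw [LF_E2]; simp [EE, fv2, fv3]) (by rw [LF_E2]; simp [EE, fv1, fv3]) hy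
  have h2 := OO_tr (EE_Lam M 0 (by simp)) (Lam_smul k (EE_Lam M 3 (by simp [fv3])))
    (by rw [LF_E0]; simp [EE, fv1]) (by rw [LF_E0]; simp [EE, fv1, fv3]) h1
  refine absurd (hmin _ (a - k * (c % a)) h2 ?_ hk0) (not_le.2 hk)
  have e : ((c % a : ℤ) : ℚ) = c - (c / a : ℤ) * a := by
    rw [Int.emod_def]; push_cast; ring
  push_cast
  rw [e]
  simp [tr_apply, LF_E0, LF_E1, LF_E2, LF_E3, LF_smul_left, LF_smul_right, EE, fv0, fv1, fv2, fv3,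
    hya, hyc]

lemma dvd3 (M : ℕ) {w y : VV (M+4)} {a c : ℤ} (hmin : MinA M w a) (hy : OO (M+4) w y)
    (ha : a ≠ 0) (hya : y 0 = a) (hyc : y 3 = c) : a ∣ c := by
  by_contra hn
  have hr : c % a ≠ 0 := fun h => hn (Int.dvd_of_emod_eq_zero h)
  obtain ⟨k, hk0, hk⟩ := euclid a c ha hr
  have h1 := OO_tr (EE_Lam M 3 (by simp [fv3])) (Lam_smul (c / a) (EE_Lam M 1 (by simp [fv1])))
    (by rw [LF_E3]; simp [EE, fv2, fv3]) (by rw [LF_E3]; simp [EE, fv1, fv2]) hy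
  have h2 := OO_tr (EE_Lam M 0 (by simp)) (Lam_smul k (EE_Lam M 2 (by simp [fv2])))
    (by rw [LF_E0]; simp [EE, fv1]) (by rw [LF_E0]; simp [EE, fv1, fv2]) h1
  refine absurd (hmin _ (a - k * (c % a)) h2 ?_ hk0) (not_le.2 hk)
  have e : ((c % a : ℤ) : ℚ) = c - (c / a : ℤ) * a := by
    rw [Int.emod_def]; push_cast; ring
  push_cast
  rw [e]
  simp [tr_apply, LF_E0, LF_E1, LF_E2, LF_E3, LF_smul_left, LF_smul_right, EE, fv0, fv1, fv2, fv3,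
    hya, hyc]

/-- with `y 3 = 0`, all pairings are divisible by `a`. -/
lemma dvd_all (M : ℕ) {w y : VV (M+4)} {a : ℤ} (hmin : MinA M w a) (hy : OO (M+4) w y)
    (ha : a ≠ 0) (hya : y 0 = a) (hy3 : y 3 = 0) {x : VV (M+4)} (hx : x ∈ LamSet (M+4)) {t : ℤ}
    (ht : LamForm (M+4) x y = t) : a ∣ t := by
  obtain ⟨c, hc⟩ := hy.2 2
  obtain ⟨x2, hx2⟩ := hx.1 2
  obtain ⟨x3, hx3⟩ := hx.1 3
  have hac := dvd2 M hmin hy ha hya hc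
  set x' : VV (M+4) := x - (x2 : ℚ) • EE M 2 - (x3 : ℚ) • EE M 3 with hx'
  have hx'L : x' ∈ LamSet (M+4) :=
    Lam_sub (Lam_sub hx (Lam_smul _ (EE_Lam M 2 (by simp [fv2])))) (Lam_smul _ (EE_Lam M 3 (by simp [fv3])))
  have h1 := OO_tr (EE_Lam M 2 (by simp [fv2])) hx'L
    (by rw [LF_E2]; simp [EE, fv2, fv3]) (by rw [LF_E2]; simp [hx', EE, fv2, fv3, hx3]) hy
  have hB : LamForm (M+4) x' y = t - x3 * c := by
    rw [hx', LF_sub_left, LF_sub_left, LF_smul_left, LF_smul_left, LF_E2, LF_E3, ht, hy3, hc]; ring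
  have h2 : a ∣ c - (t - x3 * c) := by
    refine dvd2 M hmin h1 ha ?_ ?_
    · simp [tr_apply, LF_E2, hy3, hya, EE, fv2]
    · simp [tr_apply, LF_E2, hy3, hc, EE, fv2, hB]
  have h3 : t = c + x3 * c - (c - (t - x3 * c)) := by ring
  rw [h3]
  exact Dvd.dvd.sub (Dvd.dvd.add hac (Dvd.dvd.mul_left hac _)) h2 

lemma start (M : ℕ) {w : VV (M+4)} (hw : IntVec w) {x : VV (M+4)} (hx : x ∈ LamSet (M+4))
    (hwx : LamForm (M+4) x w = 1) : ∃ y, OO (M+4) w y ∧ y 0 ≠ 0 := by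
  have hO : OO (M+4) w w := ⟨RR_refl _ _, hw⟩
  by_cases h0 : w 0 = 0
  swap
  · exact ⟨w, hO, h0⟩
  by_cases h1 : w 1 = 0
  · obtain ⟨x0, hx0⟩ := hx.1 0
    obtain ⟨x1, hx1⟩ := hx.1 1
    set x' : VV (M+4) := x - (x1 : ℚ) • EE M 1 with hx'
    have hx'L : x' ∈ LamSet (M+4) :=
      Lam_sub hx (Lam_smul _ (EE_Lam M 1 (by simp [fv1])))
    refine ⟨_, OO_tr (EE_Lam M 0 (by simp)) hx'L
      (by rw [LF_E0]; simp [EE, fv1]) (by rw [LF_E0]; simp [hx', EE, fv1, hx1]) hO, ?_⟩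
    have hB : LamForm (M+4) x' w = 1 := by
      rw [hx', LF_sub_left, LF_smul_left, LF_E1, hwx, h0]; ring
    simp [tr_apply, LF_E0, h0, h1, hB, EE]
  · have key : ∀ k : ℤ, ∃ y, OO (M+4) w y ∧ y 0 = - k * (w 3 + w 2) - k * k * w 1 := by
      intro k
      refine ⟨_, OO_tr (EE_Lam M 0 (by simp)) (Lam_smul k (Lam_add (EE_Lam M 2 (by simp [fv2]))
        (EE_Lam M 3 (by simp [fv3])))) (by rw [LF_E0]; simp [EE, fv1])
          (by rw [LF_E0]; simp [EE, fv1, fv2, fv3]) hO, ?_⟩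
      simp [tr_apply, LF_E0, LF_E2, LF_E3, LF_add_left, LF_add_right, LF_smul_left, LF_smul_right,
        h0, EE, fv2, fv3]
      ring
    obtain ⟨y, hy, hy0⟩ := key 1
    obtain ⟨z, hz, hz0⟩ := key (-1)
    by_cases hh : y 0 = 0
    · refine ⟨z, hz, ?_⟩
      intro hzz
      rw [hh] at hy0; rw [hzz] at hz0
      push_cast at *
      apply h1; linarith
    · exact ⟨y, hy, hh⟩

lemma unit0 (M : ℕ) {w : VV (M+4)} (hw : IntVec w) {x : VV (M+4)} (hx : x ∈ LamSet (M+4))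
    (hwx : LamForm (M+4) x w = 1) :
    ∃ (y : VV (M+4)) (s : ℤ), OO (M+4) w y ∧ y 0 = s ∧ s * s = 1 := by
  classical
  have hex : ∃ n : ℕ, ∃ (y : VV (M+4)) (a : ℤ), OO (M+4) w y ∧ y 0 = a ∧ a ≠ 0 ∧ a.natAbs = n := by
    obtain ⟨y, hy, h0⟩ := start M hw hx hwx
    obtain ⟨a, ha⟩ := hy.2 0
    exact ⟨_, y, a, hy, ha, by rintro rfl; simp at ha; exact h0 ha, rfl⟩
  obtain ⟨y, a, hy, hya, ha, hn⟩ := Nat.find_spec hex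
  have hmin : MinA M w a := by
    intro z b hz hzb hb
    have := Nat.find_min' hex ⟨z, b, hz, hzb, hb, rfl⟩
    rw [← hn] at this
    rw [Int.abs_eq_natAbs, Int.abs_eq_natAbs]
    exact_mod_cast this
  obtain ⟨d, hd⟩ := hy.2 3
  obtain ⟨k, hk⟩ := dvd3 M hmin hy ha hya hd
  have h1 := OO_tr (EE_Lam M 3 (by simp [fv3])) (Lam_smul k (EE_Lam M 1 (by simp [fv1])))
    (by rw [LF_E3]; simp [EE, fv2, fv3]) (by rw [LF_E3]; simp [EE, fv1, fv2]) hy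
  set y' := tr (M+4) (EE M 3) ((k : ℚ) • EE M 1) y with hy'
  have hy'0 : y' 0 = a := by
    simp [hy', tr_apply, LF_E3, LF_E1, LF_smul_left, LF_smul_right, EE, fv1, fv3, hya]
  have hy'3 : y' 3 = 0 := by
    simp [hy', tr_apply, LF_E3, LF_E1, LF_smul_left, LF_smul_right, EE, fv1, fv3, hya, hd, hk]
    ring
  obtain ⟨g, hg, hgw⟩ := h1.1
  have h2 : a ∣ 1 := dvd_all M hmin h1 ha hy'0 hy'3 ((hg.2 x).2 hx)
    (by rw [← hgw, hg.1, hwx]; simp)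
  refine ⟨y, a, hy, hya, ?_⟩
  rcases Int.isUnit_iff.1 (isUnit_of_dvd_one h2) with h | h <;> simp [h]

lemma to_eps (M : ℕ) {w : VV (M+4)} (hw : IntVec w) (hw2 : LamForm (M+4) w w = -1)
    {x : VV (M+4)} (hx : x ∈ LamSet (M+4))
    (hwx : LamForm (M+4) x w = 1) : RR (M+4) w (EE M 4) := by
  obtain ⟨y, s, hy, hys, hs⟩ := unit0 M hw hx hwx
  have hsq : (s : ℚ) * s = 1 := by exact_mod_cast hs
  have hy2 : LamForm (M+4) y y = -1 := by
    obtain ⟨g, hg, hgw⟩ := hy.1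
    rw [← hgw, hg.1, hw2]
  have hodd : EE M 4 - y ∈ LamSet (M+4) := by
    obtain ⟨a, ha⟩ := LF_par hy.2
    rw [hy2] at ha
    rw [mem_Lam]
    have : EE M 4 - y = EE M 4 + ((-1 : ℤ) : ℚ) • y := by simp [sub_eq_add_neg]
    rw [this]
    refine ⟨IV_add (EE_int M 4) (IV_smul _ hy.2), 1 + a, ?_⟩
    rw [tsum4_add, tsum4_smul, tsum4_EE, fv4]
    push_cast; simp; linarith
  set x1 : VV (M+4) := (s : ℚ) • (EE M 4 - y + (s : ℚ) • EE M 0) with hx1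
  have hx1L : x1 ∈ LamSet (M+4) := Lam_smul _ (Lam_add hodd (Lam_smul _ (EE_Lam M 0 (by simp))))
  have hex1 : LamForm (M+4) (EE M 1) x1 = 0 := by
    rw [LF_E1]; simp [hx1, EE, fv4, hys]
  have h1 := OO_tr (EE_Lam M 1 (by simp [fv1])) hx1L
    (by rw [LF_E1]; simp [EE, fv1]) hex1 hy
  obtain ⟨m, hm⟩ : ∃ m : ℚ, tr (M+4) (EE M 1) x1 y = EE M 4 + (s : ℚ) • EE M 0 + m • EE M 1 := by
    refine ⟨- LamForm (M+4) x1 y - s * (LamForm (M+4) x1 x1 / 2), ?_⟩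
    rw [tr_apply, LF_E1, hys]
    ext i
    simp only [Pi.add_apply, Pi.sub_apply, Pi.smul_apply, smul_eq_mul, hx1]
    linear_combination (EE M 4 i - y i + s * EE M 0 i) * hsq
  have h44 : (4 : ℕ) ≤ ((4 : Fin (M+4+2)) : ℕ) := by rw [fv4]
  have h45 : (4 : ℕ) ≤ ((5 : Fin (M+4+2)) : ℕ) := by rw [fv5]; norm_num
  have hm0 : m = 0 := by
    have := tr_form (M+4) (EE M 1) x1 (by rw [LF_E1]; simp [EE, fv1]) hex1 y y
    rw [hm, hy2] at this
    simp only [LF_add_left, LF_smul_left, LF_E0, LF_E1, LF_Ege M 4 h44] at this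
    simp [EE, fv0, fv1, fv4] at this
    have hs0 : (s : ℚ) ≠ 0 := by rintro h; rw [h] at hsq; simp at hsq
    have h3 : (s : ℚ) * m = 0 := by linarith
    exact (mul_eq_zero.1 h3).resolve_left hs0
  rw [hm, hm0, zero_smul, add_zero] at h1
  have hL : EE M 4 + EE M 5 ∈ LamSet (M+4) := by
    rw [mem_Lam]
    refine ⟨IV_add (EE_int M 4) (EE_int M 5), 1, ?_⟩
    rw [tsum4_add, tsum4_EE, tsum4_EE, if_pos h44, if_pos h45]; norm_num
  have h2 := OO_tr (EE_Lam M 0 (by simp)) (Lam_smul (-s) hL)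
    (by rw [LF_E0]; simp [EE, fv1]) (by rw [LF_E0]; simp [EE, fv1, fv4, fv5]) h1
  convert h2.1 using 1
  rw [tr_apply, LF_E0]
  simp only [LF_add_left, LF_add_right, LF_smul_left, LF_smul_right, LF_E0, LF_E1,
    LF_Ege M 4 h44, LF_Ege M 5 h45]
  ext i
  simp [EE, fv1, fv4, fv5]

/-! reflections -/

def rf (N : ℕ) (r : VV N) : VV N →ₗ[ℚ] VV N :=
  LinearMap.id + (LB N r).smulRight ((2 : ℚ) • r)

lemma rf_apply (N : ℕ) (r y : VV N) : rf N r y = y + LamForm N r y • (2 : ℚ) • r := by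
  simp [rf, LB_apply]

lemma rf_inv (N : ℕ) (r : VV N) (hr : LamForm N r r = -1) (y : VV N) : rf N r (rf N r y) = y := by
  simp only [rf_apply, LF_add_right, LF_smul_right, hr]
  ext i
  simp only [Pi.add_apply, Pi.smul_apply, smul_eq_mul]
  ring

lemma RR_rf {N : ℕ} {r : VV N} (hr : LamForm N r r = -1) (h2 : (2 : ℚ) • r ∈ LamSet N)
    (hd : ∀ y ∈ LamSet N, ∃ a : ℤ, LamForm N r y = a) (w : VV N) : RR N w (rf N r w) := by
  have key : ∀ a ∈ LamSet N, rf N r a ∈ LamSet N := by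
    intro a ha
    obtain ⟨k, hk⟩ := hd a ha
    rw [rf_apply, hk]
    exact Lam_add ha (Lam_smul k h2)
  refine ⟨LinearEquiv.ofInvolutive (rf N r) (rf_inv N r hr), ⟨fun x y => ?_, fun x => ?_⟩, rfl⟩
  · change LamForm N (rf N r x) (rf N r y) = _
    simp only [rf_apply, LF_add_right, LF_smul_right, LF_add_left, LF_smul_left, hr]
    rw [LF_comm N x r]
    ring
  · change rf N r x ∈ LamSet N ↔ _
    constructor
    · intro h
      have := key _ h
      rwa [rf_inv N r hr] at this
    · exact key x

def HH (M : ℕ) : VV (M+4) := fun i => if 4 ≤ (i : ℕ) then 1 else 0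

lemma sum_one (M : ℕ) : (∑ i : Fin (M+4+2), if 4 ≤ (i : ℕ) then (1 : ℚ) else 0) = M + 2 := by
  rw [Fin.sum_univ_succ, Fin.sum_univ_succ, Fin.sum_univ_succ, Fin.sum_univ_succ]
  have g2 : 2 % (M+5) = 2 := Nat.mod_eq_of_lt (by omega)
  simp [add_assoc, g2]

lemma HH_int (M : ℕ) : IntVec (HH M) := by
  intro i
  unfold HH
  split_ifs
  · exact ⟨1, by simp⟩
  · exact ⟨0, by simp⟩

lemma tsum4_HH (M : ℕ) : tsum4 (M+4) (HH M) = M + 2 := by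
  rw [← sum_one]
  unfold tsum4 HH
  apply Finset.sum_congr rfl
  intro i _; split_ifs <;> rfl

lemma LF_HH (M : ℕ) (y : VV (M+4)) : LamForm (M+4) (HH M) y = - tsum4 (M+4) y := by
  unfold LamForm tsum4
  have : ∀ i : Fin (M+4+2), (if 4 ≤ (i : ℕ) then HH M i * y i else 0)
      = (if 4 ≤ (i : ℕ) then y i else 0) := by
    intro i; unfold HH; split_ifs <;> simp
  rw [Finset.sum_congr rfl (fun i _ => this i)]
  simp [HH]

/-- every admissible vector can be moved to an integral one -/
lemma to_int (M : ℕ) (v w : VV (M+4)) (hvw : v = (2 : ℚ) • w) (hv : v ∈ LamSet (M+4))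
    (hv2 : LamForm (M+4) v v = -4)
    (hd : ∀ x ∈ LamSet (M+4), ∃ a : ℤ, LamForm (M+4) w x = a) :
    ∃ w', IntVec w' ∧ RR (M+4) w w' := by
  have hvi : ∀ i, v i = 2 * w i := by intro i; rw [hvw]; simp
  choose p hp using hv.1
  have hlow : ∀ i : Fin (M+4+2), (i : ℕ) < 4 → ∃ a : ℤ, w i = a := by
    intro i hi
    have h0 := hd _ (EE_Lam M 0 (by simp))
    have h1 := hd _ (EE_Lam M 1 (by simp))
    have h2 := hd _ (EE_Lam M 2 (by simp))
    have h3 := hd _ (EE_Lam M 3 (by simp))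
    rw [LF_comm, LF_E0] at h0
    rw [LF_comm, LF_E1] at h1
    rw [LF_comm, LF_E2] at h2
    rw [LF_comm, LF_E3] at h3
    have : i = 0 ∨ i = 1 ∨ i = 2 ∨ i = 3 := by
      simp only [Fin.ext_iff, fv0, fv1, fv2, fv3]; omega
    rcases this with rfl | rfl | rfl | rfl
    · exact h1
    · exact h0
    · exact h3
    · exact h2
  have h44 : (4 : ℕ) ≤ ((4 : Fin (M+4+2)) : ℕ) := by rw [fv4]
  have hcong : ∀ i : Fin (M+4+2), 4 ≤ (i : ℕ) → ∃ a : ℤ, p i + p 4 = 2 * a := by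
    intro i hi
    have hL : EE M i + EE M 4 ∈ LamSet (M+4) := by
      rw [mem_Lam]
      refine ⟨IV_add (EE_int M i) (EE_int M 4), 1, ?_⟩
      rw [tsum4_add, tsum4_EE, tsum4_EE, if_pos h44, if_pos hi]; norm_num
    obtain ⟨a, ha⟩ := hd _ hL
    rw [LF_comm, LF_add_left, LF_Ege M i hi, LF_Ege M 4 h44] at ha
    refine ⟨-a, ?_⟩
    have : (p i : ℚ) + p 4 = 2 * (-a) := by
      rw [← hp, ← hp, hvi, hvi, ← ha]; ring
    exact_mod_cast this
  rcases Int.even_or_odd (p 4) with he | ho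
  · refine ⟨w, ?_, RR_refl _ _⟩
    intro i
    by_cases hi : (i : ℕ) < 4
    · exact hlow i hi
    · obtain ⟨a, ha⟩ := hcong i (by omega)
      obtain ⟨b, hb⟩ := he
      refine ⟨a - b, ?_⟩
      have h1 : p i = 2 * (a - b) := by omega
      have h2 := hp i
      rw [hvi, h1] at h2
      push_cast at h2 ⊢
      linarith
  -- spinor case
  have hodd : ∀ i : Fin (M+4+2), 4 ≤ (i : ℕ) → ∃ q : ℤ, p i = 2 * q + 1 := by
    intro i hi
    obtain ⟨a, ha⟩ := hcong i hi
    obtain ⟨b, hb⟩ := ho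
    exact ⟨a - b - 1, by omega⟩
  have hsq : ∀ i : Fin (M+4+2), ∃ t : ℤ, 4 ≤ (i : ℕ) → p i * p i = 1 + 8 * t := by
    intro i
    by_cases hi : 4 ≤ (i : ℕ)
    · obtain ⟨q, hq⟩ := hodd i hi
      obtain ⟨t, ht⟩ := Int.even_mul_succ_self q
      exact ⟨t, fun _ => by rw [hq]; linarith⟩
    · exact ⟨0, fun h => absurd h hi⟩
  choose t ht using hsq
  obtain ⟨k, hk⟩ : ∃ k : ℤ, (M : ℚ) + 2 = 4 + 8 * k := by
    obtain ⟨a0, ha0⟩ := hlow 0 (by simp)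
    obtain ⟨a1, ha1⟩ := hlow 1 (by simp)
    obtain ⟨a2, ha2⟩ := hlow 2 (by simp)
    obtain ⟨a3, ha3⟩ := hlow 3 (by simp)
    refine ⟨a0 * a1 + a2 * a3 - ∑ i : Fin (M+4+2), (if 4 ≤ (i : ℕ) then t i else 0), ?_⟩
    unfold LamForm at hv2
    have : ∀ i : Fin (M+4+2), (if 4 ≤ (i : ℕ) then v i * v i else 0)
      = (if 4 ≤ (i : ℕ) then (1 : ℚ) else 0) + 8 * (if 4 ≤ (i : ℕ) then (t i : ℚ) else 0) := by
      intro i; split_ifs with h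
      · rw [hp]; exact_mod_cast ht i h
      · simp
    rw [Finset.sum_congr rfl (fun i _ => this i), Finset.sum_add_distrib, sum_one,
      ← Finset.mul_sum, hvi, hvi, hvi, hvi, ha0, ha1, ha2, ha3] at hv2
    push_cast
    linarith
  set r : VV (M+4) := EE M 0 + (k : ℚ) • EE M 1 + (1/2 : ℚ) • HH M with hr
  have hBr : ∀ y, LamForm (M+4) r y = y 1 + k * y 0 - tsum4 (M+4) y / 2 := by
    intro y
    rw [hr, LF_add_left, LF_add_left, LF_smul_left, LF_smul_left, LF_E0, LF_E1, LF_HH]; ring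
  have hHL : HH M ∈ LamSet (M+4) := by
    rw [mem_Lam]
    exact ⟨HH_int M, 2 + 4 * k, by rw [tsum4_HH, hk]; push_cast; ring⟩
  have hr2L : (2 : ℚ) • r ∈ LamSet (M+4) := by
    have : (2 : ℚ) • r = ((2 : ℤ) : ℚ) • EE M 0 + ((2 * k : ℤ) : ℚ) • EE M 1 + HH M := by
      ext i; simp [hr]; ring
    rw [this]
    exact Lam_add (Lam_add (Lam_smul _ (EE_Lam M 0 (by simp))) (Lam_smul _ (EE_Lam M 1 (by simp)))) hHL
  have h2E : ((2 : ℤ) : ℚ) • EE M 4 ∈ LamSet (M+4) := by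
    rw [mem_Lam]
    refine ⟨IV_smul _ (EE_int M 4), 1, ?_⟩
    rw [tsum4_smul, tsum4_EE, if_pos h44]; simp
  have hr0 : r 0 = 1 := by simp [hr, EE, HH]
  have hr1 : r 1 = k := by simp [hr, EE, HH]
  have hr4 : r 4 = 1/2 := by simp [hr, EE, HH]
  have hts : tsum4 (M+4) r = (M + 2) / 2 := by
    rw [hr, tsum4_add, tsum4_add, tsum4_smul, tsum4_smul, tsum4_EE, tsum4_EE, tsum4_HH]
    simp; ring
  have hrr : LamForm (M+4) r r = -1 := by
    rw [hBr, hr0, hr1, hts, hk]; ring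
  have hrd : ∀ y ∈ LamSet (M+4), ∃ a : ℤ, LamForm (M+4) r y = a := by
    intro y hy
    obtain ⟨hyi, a, ha⟩ := (mem_Lam _ _).1 hy
    obtain ⟨y0, hy0⟩ := hyi 0
    obtain ⟨y1, hy1⟩ := hyi 1
    exact ⟨y1 + k * y0 - a, by rw [hBr, ha, hy0, hy1]; push_cast; ring⟩
  have hwr : IntVec (w + r) := by
    intro i
    by_cases hi : (i : ℕ) < 4
    · obtain ⟨a, ha⟩ := hlow i hi
      obtain ⟨b, hb⟩ : ∃ b : ℤ, r i = b := by
        obtain ⟨b0, hb0⟩ := EE_int M 0 i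
        obtain ⟨b1, hb1⟩ := EE_int M 1 i
        refine ⟨b0 + k * b1, ?_⟩
        simp [hr, HH, hb0, hb1, show ¬ (4 ≤ (i : ℕ)) by omega]
      exact ⟨a + b, by simp [ha, hb]⟩
    · obtain ⟨q, hq⟩ := hodd i (by omega)
      have h2 := hp i
      rw [hvi, hq] at h2
      refine ⟨q + 1, ?_⟩
      have hri : r i = 1/2 := by
        have hi0 : (i : ℕ) ≠ 0 := by omega
        have hi1 : (i : ℕ) ≠ 1 := by omega
        have hi0' : i ≠ 0 := by rintro rfl; simp at hi0
        simp [hr, EE, HH, hi0, hi1, hi0', show (4 ≤ (i : ℕ)) by omega]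
      rw [Pi.add_apply, hri]
      push_cast at h2 ⊢
      linarith
  have fin : ∀ r' : VV (M+4), LamForm (M+4) r' r' = -1 → (2 : ℚ) • r' ∈ LamSet (M+4) →
      (∀ y ∈ LamSet (M+4), ∃ a : ℤ, LamForm (M+4) r' y = a) → IntVec (w + r') →
      (∃ l : ℤ, LamForm (M+4) ((2 : ℚ) • r') w = 2 * l + 1) → ∃ w', IntVec w' ∧ RR (M+4) w w' := by
    rintro r' h1 h2 h3 h4 ⟨l, hl⟩
    refine ⟨_, ?_, RR_rf h1 h2 h3 w⟩
    have : rf (M+4) r' w = (w + r') + (l : ℚ) • ((2 : ℚ) • r') := by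
      rw [LF_smul_left] at hl
      rw [rf_apply]
      ext i
      simp only [Pi.add_apply, Pi.smul_apply, smul_eq_mul]
      linear_combination r' i * hl
    rw [this]
    exact IV_add h4 (IV_smul l h2.1)
  obtain ⟨m, hm⟩ := hd _ hr2L
  rw [LF_comm] at hm
  rcases Int.even_or_odd m with hme | hmo
  · refine fin (r - EE M 4) ?_ ?_ ?_ ?_ ?_
    · rw [LF_sub_left, LF_sub_right, LF_Ege M 4 h44, hBr (EE M 4), hrr, tsum4_EE, if_pos h44,
        Pi.sub_apply, hr4]
      simp [EE]; norm_num
    · have : (2 : ℚ) • (r - EE M 4) = (2 : ℚ) • r - ((2 : ℤ) : ℚ) • EE M 4 := by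
        rw [smul_sub]; simp
      rw [this]
      exact Lam_sub hr2L h2E
    · intro y hy
      obtain ⟨a, ha⟩ := hrd y hy
      obtain ⟨b, hb⟩ := hy.1 4
      exact ⟨a + b, by rw [LF_sub_left, ha, LF_Ege M 4 h44, hb]; push_cast; ring⟩
    · have : w + (r - EE M 4) = (w + r) + ((-1 : ℤ) : ℚ) • EE M 4 := by
        ext i; simp; ring
      rw [this]
      exact IV_add hwr (IV_smul _ (EE_int M 4))
    · obtain ⟨c, hc⟩ := hme
      obtain ⟨b, hb⟩ := ho
      refine ⟨c + b, ?_⟩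
      have h2 := hp 4
      rw [hvi, hb] at h2
      rw [smul_sub, LF_sub_left, hm, hc, LF_smul_left, LF_Ege M 4 h44]
      push_cast at h2 ⊢
      linarith
  · obtain ⟨l, hl⟩ := hmo
    exact fin r hrr hr2L hrd hwr ⟨l, by rw [hm, hl]; push_cast; ring⟩

/-! the standard embedding -/

def pp (M : ℕ) : Fin (M+3+2+1) := ⟨4, by omega⟩

def F0 (M : ℕ) : VV (M+3) →ₗ[ℚ] VV (M+4) where
  toFun x := fun j => (pp M).insertNth (α := fun _ => ℚ) 0 x j
  map_add' x y := by
    funext j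
    cases j using (pp M).succAboveCases <;> simp
  map_smul' c x := by
    funext j
    cases j using (pp M).succAboveCases <;> simp

lemma F0_p (M : ℕ) (x) : F0 M x (pp M) = 0 := by simp [F0]

lemma F0_s (M : ℕ) (x : VV (M+3)) (i) : F0 M x ((pp M).succAbove i) = x i := by simp [F0]

lemma val_s (M : ℕ) (i : Fin (M+3+2)) :
    (((pp M).succAbove i : Fin (M+3+2+1)) : ℕ) = if (i : ℕ) < 4 then (i : ℕ) else i + 1 := by
  unfold Fin.succAbove pp
  simp only [Fin.lt_def, Fin.val_castSucc]
  split_ifs <;> simp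

lemma F0_low (M : ℕ) (x : VV (M+3)) (i : Fin (M+3+2)) (j : Fin (M+4+2)) (hi : (i : ℕ) < 4)
    (hij : (j : ℕ) = i) : F0 M x j = x i := by
  have : j = (pp M).succAbove i := by
    apply Fin.ext
    have := val_s M i
    rw [if_pos hi] at this
    rw [hij]; exact this.symm
  rw [this, F0_s]

lemma F0_sum (M : ℕ) (f : Fin (M+4+2) → ℚ) (h : f (pp M) = 0) :
    (∑ i : Fin (M+4+2), if 4 ≤ (i : ℕ) then f i else 0)
      = ∑ i : Fin (M+3+2), if 4 ≤ (i : ℕ) then f ((pp M).succAbove i) else 0 := by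
  have := Fin.sum_univ_succAbove (fun i : Fin (M+3+2+1) => if 4 ≤ (i : ℕ) then f i else 0) (pp M)
  refine this.trans ?_
  have h' : (if 4 ≤ ((pp M : Fin (M+3+2+1)) : ℕ) then f (pp M) else 0) = 0 := by
    rw [h]; simp
  rw [h', zero_add]
  apply Finset.sum_congr rfl
  intro i _
  have e : 4 ≤ (((pp M).succAbove i : Fin (M+3+2+1)) : ℕ) ↔ 4 ≤ (i : ℕ) := by
    rw [val_s]; split_ifs <;> omega
  simp only [e]

lemma F0_form (M : ℕ) (x y : VV (M+3)) :
    LamForm (M+4) (F0 M x) (F0 M y) = LamForm (M+3) x y := by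
  have g2 : 2 % (M+3+2) = 2 := Nat.mod_eq_of_lt (by omega)
  have g3 : 3 % (M+3+2) = 3 := Nat.mod_eq_of_lt (by omega)
  have l0 : ∀ x, F0 M x 0 = x 0 := fun x => F0_low M x 0 0 (by simp) (by simp)
  have l1 : ∀ x, F0 M x 1 = x 1 := fun x => F0_low M x 1 1 (by simp) (by simp)
  have l2 : ∀ x, F0 M x 2 = x 2 := fun x => F0_low M x 2 2 (by simp [g2]) (by simp [g2])
  have l3 : ∀ x, F0 M x 3 = x 3 := fun x => F0_low M x 3 3 (by simp [g3]) (by simp [g3])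
  unfold LamForm
  rw [F0_sum M (fun i => F0 M x i * F0 M y i) (by simp [F0_p])]
  simp only [F0_s, l0, l1, l2, l3]

lemma F0_int (M : ℕ) (x : VV (M+3)) : IntVec (F0 M x) ↔ IntVec x := by
  constructor
  · intro h i
    have := h ((pp M).succAbove i)
    rwa [F0_s] at this
  · intro h j
    cases j using (pp M).succAboveCases with
    | x => exact ⟨0, by rw [F0_p]; simp⟩
    | p i => rw [F0_s]; exact h i

lemma F0_Lam (M : ℕ) (x : VV (M+3)) : F0 M x ∈ LamSet (M+4) ↔ x ∈ LamSet (M+3) := by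
  rw [mem_Lam, mem_Lam, F0_int]
  unfold tsum4
  rw [F0_sum M (fun i => F0 M x i) (by simp [F0_p])]
  simp only [F0_s]

lemma F0_surj (M : ℕ) (y : VV (M+4)) (h : y (pp M) = 0) : ∃ x, F0 M x = y := by
  refine ⟨fun i => y ((pp M).succAbove i), ?_⟩
  funext j
  cases j using (pp M).succAboveCases with
  | x => rw [F0_p, h]
  | p i => rw [F0_s]

lemma F0_inj (M : ℕ) : Function.Injective (F0 M) := by
  intro x y h
  funext i
  rw [← F0_s M x i, h, F0_s]

lemma main_aux (M : ℕ) (v : VV (M+4)) (hv : v ∈ LamSet (M+4))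
    (hv2 : LamForm (M+4) v v = -4) (hdiv : HasDiv (M+4) v 2) :
    ∃ F : VV (M+3) →ₗ[ℚ] VV (M+4),
      Function.Injective F ∧
      (∀ x y, LamForm (M+4) (F x) (F y) = LamForm (M+3) x y) ∧
      F '' LamSet (M+3) = {x | x ∈ LamSet (M+4) ∧ LamForm (M+4) x v = 0} := by
  set w : VV (M+4) := (1/2 : ℚ) • v with hw
  have hvw : v = (2 : ℚ) • w := by rw [hw, smul_smul]; norm_num
  have hd : ∀ x ∈ LamSet (M+4), ∃ a : ℤ, LamForm (M+4) w x = a := by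
    intro x hx
    obtain ⟨a, ha⟩ := hdiv.1 x hx
    exact ⟨a, by rw [hw, LF_smul_left, ha]; push_cast; ring⟩
  obtain ⟨x, hx, hx2⟩ := hdiv.2
  obtain ⟨w', hw', hR⟩ := to_int M v w hvw hv hv2 hd
  have hR2 : RR (M+4) w (EE M 4) := by
    obtain ⟨g, hg, hgw⟩ := id hR
    refine RR_trans hR (to_eps M hw' ?_ ((hg.2 x).2 hx) ?_)
    · rw [← hgw, hg.1, hw, LF_smul_left, LF_smul_right, hv2]; norm_num
    · rw [← hgw, hg.1, hw, LF_smul_right, LF_comm, hx2]; norm_num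
  obtain ⟨g, hg, hgw⟩ := hR2
  have hp4 : (4 : Fin (M+4+2)) = pp M := by apply Fin.ext; rw [fv4]; rfl
  have hperp : ∀ x, LamForm (M+4) x v = 0 ↔ g x (pp M) = 0 := by
    intro x
    rw [hvw, LF_smul_right, ← hg.1, hgw, LF_comm, LF_Ege M 4 (by rw [fv4]), hp4]
    simp
  refine ⟨g.symm.toLinearMap ∘ₗ F0 M, ?_, ?_, ?_⟩
  · exact g.symm.injective.comp (F0_inj M)
  · intro x y
    rw [← F0_form M x y, ← hg.1]
    simp
  · ext y
    simp only [Set.mem_image, Set.mem_ofPred_eq, hperp]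
    constructor
    · rintro ⟨x, hx, rfl⟩
      rw [← hg.2]
      simp [F0_Lam, hx, F0_p]
    · rintro ⟨h1, h2⟩
      obtain ⟨x, hx⟩ := F0_surj M (g y) h2
      refine ⟨x, ?_, ?_⟩
      · rw [← F0_Lam, hx, hg.2]; exact h1
      · simp [hx]

/-- Let `(Λ, ξ)` be a decorated `D`-lattice of dimension `N ≥ 4` (realized as `Λ_N`),
and let `v` be a hyperelliptic vector: `v² = -4`, `div(v) = 2` (so that `v* = ξ` is the
decoration).  Then `v^⊥ ⊂ Λ_N` is isomorphic, as a lattice, to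
`Λ_{N-1} = U² ⊕ D_{N-3}`. -/
theorem statement5 (N : ℕ) (hN : 4 ≤ N)
    (v : Fin (N + 2) → ℚ) (hv : v ∈ LamSet N)
    (hv2 : LamForm N v v = -4)
    (hdiv : HasDiv N v 2) :
    ∃ F : (Fin (N - 1 + 2) → ℚ) →ₗ[ℚ] (Fin (N + 2) → ℚ),
      Function.Injective F ∧
      (∀ x y, LamForm N (F x) (F y) = LamForm (N - 1) x y) ∧
      F '' LamSet (N - 1) = {x | x ∈ LamSet N ∧ LamForm N x v = 0} := by
  obtain ⟨M, rfl⟩ : ∃ M, N = M + 4 := ⟨N - 4, by omega⟩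
  exact main_aux M v hv hv2 hdiv
end
end

section
/- Let (Λ, ξ) be a decorated D-lattice of dimension N with N ≡ 3 (mod 8), and write N = 8k+3. If v ∈ Λ is a unigonal vector (v² = -4, div(v) = 4), then Λ = ⟨v⟩ ⊕ v^⊥ and v^⊥ is isomorphic to the even unimodular lattice II_{2,2+8k}. -/
noncomputable section

open scoped BigOperators

set_option linter.unusedSectionVars false
set_option linter.deprecated false
/-- The subring of integers in `ℚ`. -/
abbrev ZQ : Subring ℚ := (Int.castRingHom ℚ).range

theorem mem_ZQ {q : ℚ} : q ∈ ZQ ↔ ∃ a : ℤ, q = (a : ℚ) := by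
  simp [ZQ, RingHom.mem_range, eq_comm]

theorem int_mem_ZQ (a : ℤ) : (a : ℚ) ∈ ZQ := mem_ZQ.2 ⟨a, rfl⟩

/-- Ambient space `U² ⊕ ℚ^ι`. -/
abbrev Amb (ι : Type) := (Fin 4 → ℚ) × (ι → ℚ)

section eichler

variable {ι : Type} [Fintype ι] [DecidableEq ι]

/-- The form on `U² ⊕ ℚ^ι`. -/
def BA (x y : Amb ι) : ℚ := UForm x.1 y.1 - x.2 ⬝ᵥ y.2

/-- The lattice `U² ⊕ D_ι`. -/
def LA (ι : Type) [Fintype ι] : Set (Amb ι) :=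
  {x | (∀ i, x.1 i ∈ ZQ) ∧ (∀ i, x.2 i ∈ ZQ) ∧ (∑ i, x.2 i) / 2 ∈ ZQ}

/-- Isometries of the lattice. -/
def IsoA (g : Amb ι ≃ₗ[ℚ] Amb ι) : Prop :=
  (∀ x y, BA (g x) (g y) = BA x y) ∧ ∀ x, g x ∈ LA ι ↔ x ∈ LA ι

theorem half_sq_add (a : ℚ) (h : a ∈ ZQ) : (a * a - a) / 2 ∈ ZQ := by
  obtain ⟨n, rfl⟩ := mem_ZQ.1 h
  obtain ⟨m, hm⟩ := Int.even_mul_pred_self n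
  refine mem_ZQ.2 ⟨m, ?_⟩
  have : ((n * (n - 1) : ℤ) : ℚ) = ((m + m : ℤ) : ℚ) := by rw [hm]
  push_cast at this
  linarith

theorem half_dot_sub (b : ι → ℚ) (h : ∀ i, b i ∈ ZQ) :
    (b ⬝ᵥ b - ∑ i, b i) / 2 ∈ ZQ := by
  have : (b ⬝ᵥ b - ∑ i, b i) / 2 = ∑ i, (b i * b i - b i) / 2 := by
    rw [dotProduct, ← Finset.sum_sub_distrib, Finset.sum_div]
  rw [this]
  exact sum_mem fun i _ => half_sq_add _ (h i)

theorem half_dot (b : ι → ℚ) (h : ∀ i, b i ∈ ZQ) (hs : (∑ i, b i) / 2 ∈ ZQ) :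
    (b ⬝ᵥ b) / 2 ∈ ZQ := by
  have := add_mem (half_dot_sub b h) hs
  convert this using 1
  ring

theorem IsoA.refl : IsoA (LinearEquiv.refl ℚ (Amb ι)) := ⟨fun _ _ => rfl, fun _ => Iff.rfl⟩

theorem IsoA.trans {g h : Amb ι ≃ₗ[ℚ] Amb ι} (hg : IsoA g) (hh : IsoA h) :
    IsoA (g.trans h) :=
  ⟨fun x y => by simp [hh.1, hg.1], fun x => by simp [hh.2, hg.2]⟩

theorem IsoA.symm {g : Amb ι ≃ₗ[ℚ] Amb ι} (hg : IsoA g) : IsoA g.symm :=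
  ⟨fun x y => by rw [← hg.1]; simp, fun x => by rw [← hg.2]; simp⟩

/-- Equivalence of vectors under lattice isometries. -/
def EqvA (v w : Amb ι) : Prop := ∃ g : Amb ι ≃ₗ[ℚ] Amb ι, IsoA g ∧ g v = w

theorem EqvA.trans {u v w : Amb ι} (h1 : EqvA u v) (h2 : EqvA v w) : EqvA u w := by
  obtain ⟨g, hg, rfl⟩ := h1
  obtain ⟨h, hh, rfl⟩ := h2
  exact ⟨g.trans h, hg.trans hh, rfl⟩

theorem EqvA.symm {u v : Amb ι} (h1 : EqvA u v) : EqvA v u := by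
  obtain ⟨g, hg, rfl⟩ := h1
  exact ⟨g.symm, hg.symm, by simp⟩

/-- `SL₂` action on `U²`. -/
def slMap (p q r s : ℚ) : Amb ι →ₗ[ℚ] Amb ι where
  toFun x := (![p * x.1 0 - q * x.1 3, r * x.1 2 + s * x.1 1, p * x.1 2 + q * x.1 1,
    s * x.1 3 - r * x.1 0], x.2)
  map_add' x y := by
    ext i
    · fin_cases i <;> simp <;> ring
    · simp
  map_smul' c x := by
    ext i
    · fin_cases i <;> simp <;> ring
    · simp

theorem slMap_inv (p q r s : ℚ) (h : p * s - q * r = 1) (x : Amb ι) :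
    slMap s (-q) (-r) p (slMap p q r s x) = x := by
  ext i
  · fin_cases i <;> simp [slMap]
    · linear_combination x.1 0 * h
    · linear_combination x.1 1 * h
    · linear_combination x.1 2 * h
    · linear_combination x.1 3 * h
  · simp [slMap]

theorem slMap_mem (p q r s : ℤ) (x : Amb ι) (hx : x ∈ LA ι) :
    slMap (p : ℚ) q r s x ∈ LA ι := by
  obtain ⟨h1, h2, h3⟩ := hx
  refine ⟨?_, h2, h3⟩
  intro i
  have := int_mem_ZQ
  fin_cases i <;> simp only [slMap] <;>
    first
    | exact sub_mem (mul_mem (this _) (h1 _)) (mul_mem (this _) (h1 _))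
    | exact add_mem (mul_mem (this _) (h1 _)) (mul_mem (this _) (h1 _))

theorem slMap_eqv (p q r s : ℤ) (h : p * s - q * r = 1) (x : Amb ι) :
    EqvA x (slMap (p : ℚ) q r s x) := by
  have hQ : (p : ℚ) * s - q * r = 1 := by exact_mod_cast h
  have hQ' : (s : ℚ) * p - (-q) * (-r) = 1 := by linear_combination hQ
  have hi := slMap_inv (ι := ι) (p : ℚ) q r s hQ
  have hi' := slMap_inv (ι := ι) (s : ℚ) (-q) (-r) p hQ'
  simp only [neg_neg] at hi'
  refine ⟨LinearEquiv.ofLinear (slMap (p : ℚ) q r s) (slMap (s : ℚ) (-q) (-r) p)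
    (LinearMap.ext hi') (LinearMap.ext hi), ⟨?_, ?_⟩, rfl⟩
  · intro x y
    simp [slMap, BA, UForm]
    linear_combination (x.1 0 * y.1 1 + x.1 1 * y.1 0 + x.1 2 * y.1 3 + x.1 3 * y.1 2) * hQ
  · intro x
    refine ⟨fun hx => ?_, fun hx => slMap_mem p q r s x hx⟩
    have := slMap_mem s (-q) (-r) p _ hx
    push_cast at this
    rw [LinearEquiv.ofLinear_apply, hi] at this
    exact this

/-- Swap of the isotropic basis of the second hyperbolic plane. -/
def swMap : Amb ι →ₗ[ℚ] Amb ι where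
  toFun x := (![x.1 0, x.1 1, x.1 3, x.1 2], x.2)
  map_add' x y := by
    ext i
    · fin_cases i <;> simp
    · simp
  map_smul' c x := by
    ext i
    · fin_cases i <;> simp
    · simp

theorem sw_eqv (x : Amb ι) : EqvA x (swMap x) := by
  have hi : ∀ x : Amb ι, swMap (swMap x) = x := by
    intro x
    ext i
    · fin_cases i <;> simp [swMap]
    · simp [swMap]
  have hm : ∀ x ∈ LA ι, swMap x ∈ LA ι := by
    intro x hx
    obtain ⟨h1, h2, h3⟩ := hx
    refine ⟨?_, h2, h3⟩
    intro i
    fin_cases i <;> exact h1 _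
  refine ⟨LinearEquiv.ofLinear swMap swMap
    (LinearMap.ext hi) (LinearMap.ext hi), ⟨?_, ?_⟩, rfl⟩
  · intro x y
    simp [swMap, BA, UForm]
    ring
  · intro x
    refine ⟨fun hx => ?_, hm x⟩
    have := hm _ hx
    rw [LinearEquiv.ofLinear_apply, hi] at this
    exact this

/-- Sign change of one coordinate. -/
def flMap (i₀ : ι) : Amb ι →ₗ[ℚ] Amb ι where
  toFun x := (x.1, fun i => if i = i₀ then - x.2 i else x.2 i)
  map_add' x y := by
    ext i
    · simp
    · by_cases h : i = i₀ <;> simp [h]; ring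
  map_smul' c x := by
    ext i
    · simp
    · by_cases h : i = i₀ <;> simp [h]

theorem fl_sum (i₀ : ι) (x : Amb ι) : ∑ i, (flMap i₀ x).2 i = ∑ i, x.2 i - 2 * x.2 i₀ := by
  have : ∀ i, (flMap i₀ x).2 i = x.2 i - (if i = i₀ then 2 * x.2 i else 0) := by
    intro i
    by_cases h : i = i₀ <;> simp [flMap, h]; ring
  simp only [this, Finset.sum_sub_distrib]
  simp

theorem fl_eqv (i₀ : ι) (x : Amb ι) : EqvA x (flMap i₀ x) := by
  have hi : ∀ x : Amb ι, flMap i₀ (flMap i₀ x) = x := by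
    intro x
    ext i
    · simp [flMap]
    · by_cases h : i = i₀ <;> simp [flMap, h]
  have hm : ∀ x ∈ LA ι, flMap i₀ x ∈ LA ι := by
    intro x hx
    obtain ⟨h1, h2, h3⟩ := hx
    refine ⟨h1, ?_, ?_⟩
    · intro i
      by_cases h : i = i₀
      · simp only [flMap, h]; simpa using h2 i₀
      · simp only [flMap, LinearMap.coe_mk, AddHom.coe_mk, h, if_false]; exact h2 i
    · rw [fl_sum]
      convert sub_mem h3 (h2 i₀) using 1
      ring
  refine ⟨LinearEquiv.ofLinear (flMap i₀) (flMap i₀)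
    (LinearMap.ext hi) (LinearMap.ext hi), ⟨?_, ?_⟩, rfl⟩
  · intro x y
    simp only [flMap, BA, LinearEquiv.ofLinear_apply, LinearMap.coe_mk, AddHom.coe_mk, dotProduct]
    congr 1
    apply Finset.sum_congr rfl
    intro i _
    by_cases h : i = i₀ <;> simp [h]
  · intro x
    refine ⟨fun hx => ?_, hm x⟩
    have := hm _ hx
    rw [LinearEquiv.ofLinear_apply, hi] at this
    exact this

/-- Eichler transvection. -/
def eiMap (a₀ a₁ : ℚ) (b : ι → ℚ) : Amb ι →ₗ[ℚ] Amb ι where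
  toFun x := (![x.1 0 + x.1 3 * a₀, x.1 1 + x.1 3 * a₁,
    x.1 2 - (a₀ * x.1 1 + a₁ * x.1 0 - b ⬝ᵥ x.2) - (a₀ * a₁ - (b ⬝ᵥ b) / 2) * x.1 3, x.1 3],
    x.2 + x.1 3 • b)
  map_add' x y := by
    ext i
    · fin_cases i <;> simp <;> ring
    · simp; ring
  map_smul' c x := by
    ext i
    · fin_cases i <;> simp <;> ring
    · simp; ring

theorem eiMap_inv (a₀ a₁ : ℚ) (b : ι → ℚ) (x : Amb ι) :
    eiMap (-a₀) (-a₁) (-b) (eiMap a₀ a₁ b x) = x := by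
  ext i
  · fin_cases i <;> simp [eiMap]; ring
  · simp [eiMap]

theorem eiMap_mem (a₀ a₁ : ℚ) (b : ι → ℚ) (h0 : a₀ ∈ ZQ) (h1 : a₁ ∈ ZQ) (hb : ∀ i, b i ∈ ZQ)
    (hs : (∑ i, b i) / 2 ∈ ZQ) (x : Amb ι) (hx : x ∈ LA ι) :
    eiMap a₀ a₁ b x ∈ LA ι := by
  obtain ⟨hx1, hx2, hx3⟩ := hx
  refine ⟨?_, ?_, ?_⟩
  · intro i
    have hd : b ⬝ᵥ x.2 ∈ ZQ := sum_mem fun i _ => mul_mem (hb i) (hx2 i)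
    have hh := half_dot b hb hs
    fin_cases i
    · exact add_mem (hx1 0) (mul_mem (hx1 3) h0)
    · exact add_mem (hx1 1) (mul_mem (hx1 3) h1)
    · exact sub_mem (sub_mem (hx1 2) (sub_mem (add_mem (mul_mem h0 (hx1 1)) (mul_mem h1 (hx1 0)))
        hd)) (mul_mem (sub_mem (mul_mem h0 h1) hh) (hx1 3))
    · exact hx1 3
  · intro i
    exact add_mem (hx2 i) (mul_mem (hx1 3) (hb i))
  · have : (∑ i, (eiMap a₀ a₁ b x).2 i) / 2 = (∑ i, x.2 i) / 2 + x.1 3 * ((∑ i, b i) / 2) := by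
      simp [eiMap, Finset.sum_add_distrib, ← Finset.mul_sum]
      ring
    rw [this]
    exact add_mem hx3 (mul_mem (hx1 3) hs)

theorem ei_eqv (a₀ a₁ : ℚ) (b : ι → ℚ) (h0 : a₀ ∈ ZQ) (h1 : a₁ ∈ ZQ) (hb : ∀ i, b i ∈ ZQ)
    (hs : (∑ i, b i) / 2 ∈ ZQ) (x : Amb ι) : EqvA x (eiMap a₀ a₁ b x) := by
  have hi := eiMap_inv (ι := ι) a₀ a₁ b
  have hi' := eiMap_inv (ι := ι) (-a₀) (-a₁) (-b)
  simp only [neg_neg] at hi'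
  refine ⟨LinearEquiv.ofLinear (eiMap a₀ a₁ b) (eiMap (-a₀) (-a₁) (-b))
    (LinearMap.ext hi') (LinearMap.ext hi), ⟨?_, ?_⟩, rfl⟩
  · intro x y
    simp [eiMap, BA, UForm]
    rw [dotProduct_comm x.2 b]
    ring
  · intro x
    refine ⟨fun hx => ?_, eiMap_mem a₀ a₁ b h0 h1 hb hs x⟩
    have := eiMap_mem (-a₀) (-a₁) (-b) (neg_mem h0) (neg_mem h1) (fun i => neg_mem (hb i))
      (by simpa [neg_div] using hs) _ hx
    rw [LinearEquiv.ofLinear_apply, hi] at this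
    exact this

end eichler

section reach

variable {ι : Type} [Fintype ι] [DecidableEq ι]

theorem bez (a d : ℤ) : ∃ p q r s : ℤ, p * s - q * r = 1 ∧ s * d - r * a = 0 := by
  by_cases h : 0 < Int.gcd a d
  · obtain ⟨a', d', hc, ha, hd⟩ := Int.exists_gcd_one h
    obtain ⟨u, z, huz⟩ := Int.isCoprime_iff_gcd_eq_one.2 hc
    refine ⟨u, -z, d', a', by linarith, ?_⟩
    generalize ((Int.gcd a d : ℕ) : ℤ) = g at ha hd
    rw [ha, hd]; ring
  · have h0 : Int.gcd a d = 0 := by omega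
    rw [Int.gcd_eq_zero_iff] at h0
    exact ⟨1, 0, 0, 1, by simp, by simp [h0.1, h0.2]⟩

/-- Dual vectors of the relevant type. -/
def GoodA (w : Amb ι) : Prop :=
  (∀ i, w.1 i ∈ ZQ) ∧ (∀ i, w.2 i - 1 / 2 ∈ ZQ) ∧ BA w w = -1 / 4

theorem EqvA.norm {v w : Amb ι} (h : EqvA v w) : BA w w = BA v v := by
  obtain ⟨g, hg, rfl⟩ := h
  exact hg.1 _ _

theorem nat_mem_ZQ (n : ℕ) : (n : ℚ) ∈ ZQ := natCast_mem _ n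

theorem reach1 (w : Amb ι) (hw : GoodA w) : ∃ w', EqvA w w' ∧ GoodA w' ∧ w'.1 3 = 0 := by
  obtain ⟨a, ha⟩ := mem_ZQ.1 (hw.1 0)
  obtain ⟨d, hd⟩ := mem_ZQ.1 (hw.1 3)
  obtain ⟨p, q, r, s, h1, h2⟩ := bez a d
  have he := slMap_eqv p q r s h1 w
  refine ⟨_, he, ⟨?_, hw.2.1, by rw [he.norm, hw.2.2]⟩, ?_⟩
  · intro i
    have := int_mem_ZQ
    fin_cases i <;> simp only [slMap] <;>
      first
      | exact sub_mem (mul_mem (this _) (hw.1 _)) (mul_mem (this _) (hw.1 _))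
      | exact add_mem (mul_mem (this _) (hw.1 _)) (mul_mem (this _) (hw.1 _))
  · have : (s : ℚ) * d - r * a = 0 := by exact_mod_cast h2
    simpa [slMap, ha, hd] using this

theorem reach2 (w : Amb ι) (hw : GoodA w) (h3 : w.1 3 = 0) :
    ∃ w', EqvA w w' ∧ GoodA w' ∧ w'.1 3 = 1 := by
  obtain ⟨h1, h2, hn⟩ := hw
  set t : ℚ := 1 - w.1 2 with ht
  have htZ : t ∈ ZQ := sub_mem (one_mem _) (h1 2)
  have h8 : (8 : ℚ) ∈ ZQ := by exact_mod_cast nat_mem_ZQ 8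
  have h4 : (4 : ℚ) ∈ ZQ := by exact_mod_cast nat_mem_ZQ 4
  have h2Z : (2 : ℚ) ∈ ZQ := by exact_mod_cast nat_mem_ZQ 2
  have hl2 : ∀ i, 2 * w.2 i ∈ ZQ := by
    intro i
    convert add_mem (mul_mem h2Z (h2 i)) (one_mem ZQ) using 1
    ring
  have he := ei_eqv 0 (8 * w.1 1 * t) ((4 * t) • w.2) (zero_mem _)
    (mul_mem (mul_mem h8 (h1 1)) htZ) (by
      intro i
      convert mul_mem (mul_mem h2Z htZ) (hl2 i) using 1
      simp; ring) (by
      convert mul_mem htZ (sum_mem (t := Finset.univ) fun i _ => hl2 i) using 1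
      simp [← Finset.mul_sum]; ring) w
  have e1 : eiMap 0 (8 * w.1 1 * t) ((4 * t) • w.2) w = (![w.1 0, w.1 1, 1, 0], w.2) := by
    have hn' : w.2 ⬝ᵥ w.2 = 1 / 4 + 2 * (w.1 0 * w.1 1) := by
      simp only [BA, UForm, h3] at hn
      linarith
    ext i
    · fin_cases i <;> simp [eiMap, h3]
      rw [hn', ht]; ring
    · simp [eiMap, h3]
  rw [e1] at he
  have he2 := he.trans (sw_eqv _)
  refine ⟨_, he2, ⟨?_, h2, by rw [he2.norm, hn]⟩, ?_⟩
  · intro i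
    fin_cases i
    · exact h1 0
    · exact h1 1
    · exact zero_mem _
    · exact one_mem _
  · simp [swMap]

theorem reach3 [Nonempty ι] (w : Amb ι) (hw : GoodA w) (h3 : w.1 3 = 1) :
    ∃ w', EqvA w w' ∧ GoodA w' ∧ w'.1 3 = 1 ∧ (∑ i, (1 / 2 - w'.2 i)) / 2 ∈ ZQ := by
  obtain ⟨h1, h2, hn⟩ := hw
  by_cases hp : (∑ i, (1 / 2 - w.2 i)) / 2 ∈ ZQ
  · exact ⟨w, ⟨_, IsoA.refl, rfl⟩, ⟨h1, h2, hn⟩, h3, hp⟩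
  · obtain ⟨i₀⟩ := ‹Nonempty ι›
    have he := fl_eqv i₀ w
    refine ⟨_, he, ⟨h1, ?_, by rw [he.norm, hn]⟩, h3, ?_⟩
    · intro i
      by_cases h : i = i₀
      · convert neg_mem (add_mem (h2 i₀) (one_mem ZQ)) using 1
        simp [flMap, h]; ring
      · simpa [flMap, h] using h2 i
    · rw [Finset.sum_sub_distrib, fl_sum]
      rw [Finset.sum_sub_distrib] at hp
      have hZ : ∑ i, (1 / 2 - w.2 i) ∈ ZQ := sum_mem fun i _ => by
        convert neg_mem (h2 i) using 1; ring
      rw [Finset.sum_sub_distrib] at hZ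
      generalize (∑ i : ι, (1 / 2 : ℚ)) = A at *
      generalize (∑ i : ι, w.2 i) = B at *
      obtain ⟨m, hm⟩ := mem_ZQ.1 hZ
      obtain ⟨c, hc⟩ := mem_ZQ.1 (h2 i₀)
      rcases Int.even_or_odd' m with ⟨j, hj | hj⟩
      · exfalso
        apply hp
        rw [hm, hj]
        refine mem_ZQ.2 ⟨j, ?_⟩
        push_cast; ring
      · have hcc : w.2 i₀ = c + 1 / 2 := by linarith
        refine mem_ZQ.2 ⟨j + c + 1, ?_⟩
        rw [hj] at hm
        push_cast at hm ⊢
        rw [hcc]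
        linarith

/-- The standard vector. -/
def stdA (ι : Type) [Fintype ι] : Amb ι :=
  (![0, 0, ((Fintype.card ι : ℚ) - 1) / 8, 1], fun _ => 1 / 2)

theorem reach [Nonempty ι] (w : Amb ι) (hw : GoodA w) : EqvA w (stdA ι) := by
  obtain ⟨w1, e1, g1, h1⟩ := reach1 w hw
  obtain ⟨w2, e2, g2, h2⟩ := reach2 w1 g1 h1
  obtain ⟨w3, e3, ⟨ga, gb, gc⟩, h3, h4⟩ := reach3 w2 g2 h2
  refine ((e1.trans e2).trans e3).trans ?_
  have he := ei_eqv (-w3.1 0) (-w3.1 1) (fun i => 1 / 2 - w3.2 i) (neg_mem (ga 0)) (neg_mem (ga 1))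
    (fun i => by convert neg_mem (gb i) using 1; ring) h4 w3
  have hnn := he.norm
  rw [gc] at hnn
  convert he using 1
  have hA : ∀ i, i ≠ 2 → (eiMap (-w3.1 0) (-w3.1 1) (fun i => 1 / 2 - w3.2 i) w3).1 i
      = (stdA ι).1 i := by
    intro i hi
    fin_cases i
    · simp [eiMap, h3, stdA]
    · simp [eiMap, h3, stdA]
    · simp at hi
    · simp [eiMap, h3, stdA]
  have hB : (eiMap (-w3.1 0) (-w3.1 1) (fun i => 1 / 2 - w3.2 i) w3).2 = (stdA ι).2 := by
    ext i
    simp [eiMap, h3, stdA]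
  generalize eiMap (-w3.1 0) (-w3.1 1) (fun i => 1 / 2 - w3.2 i) w3 = z at *
  have z0 := hA 0 (by decide)
  have z1 := hA 1 (by decide)
  have z3 := hA 3 (by decide)
  symm
  ext i
  · by_cases hi : i = 2
    · subst hi
      simp only [BA, UForm, z0, z1, z3, hB] at hnn
      simp [stdA, dotProduct] at hnn ⊢
      linarith
    · exact hA i hi
  · rw [hB]

theorem good_of_div [Nonempty ι] (v : Amb ι) (hn : BA v v = -4)
    (hd : ∀ x ∈ LA ι, BA v x / 4 ∈ ZQ) : GoodA ((1 / 4 : ℚ) • v) := by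
  have hsing : ∀ (c : ℚ) (i : ι), v.2 ⬝ᵥ (Pi.single i c) = v.2 i * c := by
    intro c i; simp
  have hU : ∀ i, ((1 / 4 : ℚ) • v).1 i ∈ ZQ := by
    intro i
    have key : ∀ j : Fin 4, BA v (Pi.single j 1, 0) / 4 ∈ ZQ := by
      intro j
      apply hd
      refine ⟨?_, by simp, by simp⟩
      intro i
      by_cases h : i = j
      · subst h; simp [-RingHom.mem_range, one_mem]
      · simp [h, -RingHom.mem_range, zero_mem]
    fin_cases i
    · have := key 1
      simp [BA, UForm, -RingHom.mem_range] at this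
      simpa [-RingHom.mem_range, div_eq_inv_mul] using this
    · have := key 0
      simp [BA, UForm, -RingHom.mem_range] at this
      simpa [-RingHom.mem_range, div_eq_inv_mul] using this
    · have := key 3
      simp [BA, UForm, -RingHom.mem_range] at this
      simpa [-RingHom.mem_range, div_eq_inv_mul] using this
    · have := key 2
      simp [BA, UForm, -RingHom.mem_range] at this
      simpa [-RingHom.mem_range, div_eq_inv_mul] using this
  have hs1 : ∀ (i j : ι), (Pi.single j 1 : ι → ℚ) i ∈ ZQ := by
    intro i j
    by_cases h : i = j
    · subst h; rw [Pi.single_eq_same]; exact one_mem _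
    · rw [Pi.single_eq_of_ne h]; exact zero_mem _
  have hpair : ∀ i j : ι, v.2 i / 4 + v.2 j / 4 ∈ ZQ := by
    intro i j
    have := hd (0, Pi.single i 1 + Pi.single j 1) ⟨fun _ => zero_mem _,
      fun l => add_mem (hs1 l i) (hs1 l j), by
        simp only [Pi.add_apply, Finset.sum_add_distrib, Finset.sum_pi_single']
        simpa using one_mem ZQ⟩
    simp only [BA, dotProduct_add, hsing, UForm] at this
    convert neg_mem this using 1
    simp; ring
  obtain ⟨i₀⟩ := ‹Nonempty ι›
  have hdiff : ∀ i, v.2 i / 4 - v.2 i₀ / 4 ∈ ZQ := by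
    intro i
    convert sub_mem (hpair i i₀) (hpair i₀ i₀) using 1
    ring
  have hnn : BA ((1 / 4 : ℚ) • v) ((1 / 4 : ℚ) • v) = -1 / 4 := by
    have : BA ((1 / 4 : ℚ) • v) ((1 / 4 : ℚ) • v) = BA v v / 16 := by
      simp [BA, UForm]; ring
    rw [this, hn]; norm_num
  refine ⟨hU, ?_, hnn⟩
  obtain ⟨m, hm⟩ := mem_ZQ.1 (hpair i₀ i₀)
  rcases Int.even_or_odd' m with ⟨j, hj | hj⟩
  · exfalso
    have h0 : v.2 i₀ / 4 ∈ ZQ := mem_ZQ.2 ⟨j, by rw [hj] at hm; push_cast at hm; linarith⟩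
    have hall : ∀ i, ((1 / 4 : ℚ) • v).2 i ∈ ZQ := by
      intro i
      convert add_mem (hdiff i) h0 using 1
      simp; ring
    have hq : (-1 / 4 : ℚ) ∈ ZQ := by
      rw [← hnn]
      refine sub_mem ?_ (sum_mem fun i _ => mul_mem (hall i) (hall i))
      exact add_mem (add_mem (add_mem (mul_mem (hU _) (hU _)) (mul_mem (hU _) (hU _)))
        (mul_mem (hU _) (hU _))) (mul_mem (hU _) (hU _))
    obtain ⟨c, hc⟩ := mem_ZQ.1 hq
    have : ((4 * c : ℤ) : ℚ) = ((-1 : ℤ) : ℚ) := by push_cast; linarith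
    have := Int.cast_injective this
    omega
  · intro i
    have h0 : v.2 i₀ / 4 - 1 / 2 ∈ ZQ :=
      mem_ZQ.2 ⟨j, by rw [hj] at hm; push_cast at hm; linarith⟩
    convert add_mem (hdiff i) h0 using 1
    simp; ring

theorem eqv_of_div [Nonempty ι] (v v' : Amb ι) (hn : BA v v = -4)
    (hd : ∀ x ∈ LA ι, BA v x / 4 ∈ ZQ) (hn' : BA v' v' = -4)
    (hd' : ∀ x ∈ LA ι, BA v' x / 4 ∈ ZQ) : EqvA v v' := by
  obtain ⟨g, hg, hgv⟩ := (reach _ (good_of_div v hn hd)).trans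
    (reach _ (good_of_div v' hn' hd')).symm
  refine ⟨g, hg, ?_⟩
  rw [map_smul] at hgv
  exact smul_right_injective _ (by norm_num : (1 / 4 : ℚ) ≠ 0) hgv

end reach

section blocks

/-- Index set of the negative definite part. -/
abbrev Ix (k : ℕ) := Option (Fin k × Fin 8)

variable {k : ℕ}

/-- The `i`-th block of eight coordinates. -/
def bl (x : Amb (Ix k)) (i : Fin k) : Fin 8 → ℚ := fun l => x.2 (some (i, l))

/-- Membership in `E₈`. -/
def InE (y : Fin 8 → ℚ) : Prop :=
  ((∀ i, y i ∈ ZQ) ∨ (∀ i, y i - 1 / 2 ∈ ZQ)) ∧ (∑ i, y i) / 2 ∈ ZQ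

/-- Intermediate lattices: the first `m` blocks are `E₈`, the others are `ℤ⁸`. -/
def SL (k m : ℕ) : Set (Amb (Ix k)) :=
  {x | (∀ i, x.1 i ∈ ZQ) ∧ x.2 none ∈ ZQ ∧
    ∀ i : Fin k, ((i : ℕ) < m → InE (bl x i)) ∧ (m ≤ (i : ℕ) → ∀ l, bl x i l ∈ ZQ)}

/-- The value `D`. -/
def tD (j : Fin k) (x : Amb (Ix k)) : ℚ :=
  2 * x.1 2 + 2 * x.1 3 - ∑ l, x.2 (some (j, l))

/-- The value `γ` of the inverse. -/
def tG (j : Fin k) (x : Amb (Ix k)) : ℚ :=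
  2 * (x.1 2 + x.2 none + x.2 (some (j, 0)) + x.1 3)

theorem tD_add (j : Fin k) (x y : Amb (Ix k)) : tD j (x + y) = tD j x + tD j y := by
  simp [tD, Finset.sum_add_distrib]; ring

theorem tD_smul (j : Fin k) (c : ℚ) (x : Amb (Ix k)) : tD j (c • x) = c * tD j x := by
  simp [tD, ← Finset.mul_sum]; ring

theorem tG_add (j : Fin k) (x y : Amb (Ix k)) : tG j (x + y) = tG j x + tG j y := by
  simp [tG]; ring

theorem tG_smul (j : Fin k) (c : ℚ) (x : Amb (Ix k)) : tG j (c • x) = c * tG j x := by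
  simp [tG]; ring

/-- Neighbour step turning `ℤ⁸` into `E₈`. -/
def tMap (j : Fin k) : Amb (Ix k) →ₗ[ℚ] Amb (Ix k) where
  toFun x := (![x.1 0, x.1 1, x.1 2 - x.2 none - x.2 (some (j, 0)) + tD j x, tD j x],
    fun o => Option.elim o (x.2 none - tD j x) fun p => x.2 (some p) -
      if p.1 = j then x.1 2 / 2 + (if p.2 = 0 then tD j x else 0) else 0)
  map_add' x y := by
    ext i
    · fin_cases i <;> simp [tD_add]; ring
    · rcases i with _ | ⟨i, l⟩
      · simp [tD_add]; ring
      · by_cases h : i = j <;> by_cases h' : l = 0 <;> simp [h, h', tD_add] <;> ring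
  map_smul' c x := by
    ext i
    · fin_cases i <;> simp [tD_smul]; ring
    · rcases i with _ | ⟨i, l⟩
      · simp [tD_smul]; ring
      · by_cases h : i = j <;> by_cases h' : l = 0 <;> simp [h, h', tD_smul] <;> ring

/-- The inverse of `tMap`. -/
def tInv (j : Fin k) : Amb (Ix k) →ₗ[ℚ] Amb (Ix k) where
  toFun x := (![x.1 0, x.1 1, tG j x, x.1 3 + tG j x + (∑ l, x.2 (some (j, l))) / 2],
    fun o => Option.elim o (x.2 none + x.1 3) fun p => x.2 (some p) +
      if p.1 = j then tG j x / 2 + (if p.2 = 0 then x.1 3 else 0) else 0)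
  map_add' x y := by
    ext i
    · fin_cases i <;> simp [tG_add, Finset.sum_add_distrib]; ring
    · rcases i with _ | ⟨i, l⟩
      · simp; ring
      · by_cases h : i = j <;> by_cases h' : l = 0 <;> simp [h, h', tG_add] <;> ring
  map_smul' c x := by
    ext i
    · fin_cases i <;> simp [tG_smul, ← Finset.mul_sum]; ring
    · rcases i with _ | ⟨i, l⟩
      · simp; ring
      · by_cases h : i = j <;> by_cases h' : l = 0 <;> simp [h, h', tG_smul] <;> ring

theorem tG_tMap (j : Fin k) (x : Amb (Ix k)) : tG j (tMap j x) = x.1 2 := by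
  simp [tG, tMap]; ring

theorem tD_tInv (j : Fin k) (x : Amb (Ix k)) : tD j (tInv j x) = x.1 3 := by
  simp [tD, tInv, Fin.sum_univ_eight]; ring

theorem tInv_tMap (j : Fin k) (x : Amb (Ix k)) : tInv j (tMap j x) = x := by
  ext i
  · fin_cases i
    · simp [tInv, tMap]
    · simp [tInv, tMap]
    · simpa [tInv] using tG_tMap j x
    · have := tG_tMap j x
      simp only [tInv, LinearMap.coe_mk, AddHom.coe_mk, this]
      simp [tMap, tD, Fin.sum_univ_eight]
      ring
  · have := tG_tMap j x
    simp only [tInv, LinearMap.coe_mk, AddHom.coe_mk, this]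
    rcases i with _ | ⟨i, l⟩
    · simp [tMap]
    · by_cases h : i = j <;> by_cases h' : l = 0 <;> simp [h, h', tMap]

theorem tMap_tInv (j : Fin k) (x : Amb (Ix k)) : tMap j (tInv j x) = x := by
  have := tD_tInv j x
  ext i
  · fin_cases i
    · simp [tInv, tMap]
    · simp [tInv, tMap]
    · simp only [tMap, LinearMap.coe_mk, AddHom.coe_mk, this]
      simp [tInv, tG]
      ring
    · simpa [tMap] using this
  · simp only [tMap, LinearMap.coe_mk, AddHom.coe_mk, this]
    rcases i with _ | ⟨i, l⟩
    · simp [tInv]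
    · by_cases h : i = j <;> by_cases h' : l = 0 <;> simp [h, h', tInv]

theorem dot_split (j : Fin k) (x y : Ix k → ℚ) :
    x ⬝ᵥ y = x none * y none + (∑ l, x (some (j, l)) * y (some (j, l)) +
      ∑ i ∈ Finset.univ.erase j, ∑ l, x (some (i, l)) * y (some (i, l))) := by
  rw [dotProduct, Fintype.sum_option, Fintype.sum_prod_type, Finset.add_sum_erase _
    (fun i => ∑ l, x (some (i, l)) * y (some (i, l))) (Finset.mem_univ j)]

theorem tMap_iso (j : Fin k) (x y : Amb (Ix k)) : BA (tMap j x) (tMap j y) = BA x y := by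
  have hr : ∑ i ∈ Finset.univ.erase j, ∑ l, (tMap j x).2 (some (i, l)) * (tMap j y).2 (some (i, l))
      = ∑ i ∈ Finset.univ.erase j, ∑ l, x.2 (some (i, l)) * y.2 (some (i, l)) := by
    apply Finset.sum_congr rfl
    intro i hi
    have : i ≠ j := Finset.ne_of_mem_erase hi
    simp [tMap, this]
  rw [BA, BA, dot_split j, dot_split j x.2, hr]
  simp [tMap, tD, Fin.sum_univ_eight, UForm]
  ring

theorem two_mem_ZQ : (2 : ℚ) ∈ ZQ := by exact_mod_cast nat_mem_ZQ 2

theorem tMap_mem (j : Fin k) (x : Amb (Ix k)) (hx : x ∈ SL k j) : tMap j x ∈ SL k (j + 1) := by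
  obtain ⟨h1, h2, h3⟩ := hx
  have hj : ∀ l, x.2 (some (j, l)) ∈ ZQ := fun l => (h3 j).2 le_rfl l
  have hD : tD j x ∈ ZQ := sub_mem (add_mem (mul_mem two_mem_ZQ (h1 2)) (mul_mem two_mem_ZQ (h1 3)))
    (sum_mem fun l _ => hj l)
  refine ⟨?_, sub_mem h2 hD, ?_⟩
  · intro i
    fin_cases i
    · exact h1 0
    · exact h1 1
    · exact add_mem (sub_mem (sub_mem (h1 2) h2) (hj 0)) hD
    · exact hD
  · intro i
    by_cases hij : i = j
    · subst hij
      refine ⟨fun _ => ?_, fun h => by omega⟩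
      have hb : ∀ l, bl (tMap i x) i l
          = x.2 (some (i, l)) - (x.1 2 / 2 + (if l = 0 then tD i x else 0)) := by
        intro l; simp [bl, tMap]
      have hif : ∀ l : Fin 8, (if l = 0 then tD i x else 0) ∈ ZQ := by
        intro l; split_ifs
        · exact hD
        · exact zero_mem _
      refine ⟨?_, ?_⟩
      · obtain ⟨m, hm⟩ := mem_ZQ.1 (h1 2)
        rcases Int.even_or_odd' m with ⟨c, hc | hc⟩
        · left
          intro l
          rw [hb]
          refine sub_mem (hj l) (add_mem (mem_ZQ.2 ⟨c, ?_⟩) (hif l))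
          rw [hm, hc]; push_cast; ring
        · right
          intro l
          rw [hb]
          convert sub_mem (hj l) (add_mem (int_mem_ZQ (c + 1)) (hif l)) using 1
          rw [hm, hc]; push_cast; ring
      · convert sub_mem (sum_mem (t := Finset.univ) fun l _ => hj l)
          (add_mem (h1 3) (add_mem (h1 2) (mul_mem two_mem_ZQ (h1 2)))) using 1
        simp only [hb]
        simp [Fin.sum_univ_eight, tD]; ring
    · have hb : bl (tMap j x) i = bl x i := by
        ext l; simp [bl, tMap, hij]
      have : (i : ℕ) ≠ j := fun h => hij (Fin.ext h)
      rw [hb]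
      exact ⟨fun h => (h3 i).1 (by omega), fun h => (h3 i).2 (by omega)⟩

theorem tInv_mem (j : Fin k) (x : Amb (Ix k)) (hx : x ∈ SL k (j + 1)) : tInv j x ∈ SL k j := by
  obtain ⟨h1, h2, h3⟩ := hx
  obtain ⟨hj, hs⟩ := (h3 j).1 (by omega)
  have hs' : (∑ l, x.2 (some (j, l))) / 2 ∈ ZQ := hs
  have hG : tG j x ∈ ZQ ∧ ∀ l, x.2 (some (j, l)) + tG j x / 2 ∈ ZQ := by
    have e : ∀ l, x.2 (some (j, l)) + tG j x / 2
       = x.2 (some (j, l)) + x.2 (some (j, 0)) + (x.1 2 + x.2 none + x.1 3) := by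
      intro l; rw [tG]; ring
    have hB : x.1 2 + x.2 none + x.1 3 ∈ ZQ := add_mem (add_mem (h1 2) h2) (h1 3)
    have hp : ∀ l, x.2 (some (j, l)) + x.2 (some (j, 0)) ∈ ZQ := by
      intro l
      rcases hj with hj | hj
      · exact add_mem (hj l) (hj 0)
      · convert add_mem (add_mem (hj l) (hj 0)) (one_mem ZQ) using 1
        simp only [bl]; ring
    constructor
    · convert add_mem (hp 0) (mul_mem two_mem_ZQ hB) using 1
      rw [tG]; ring
    · intro l
      rw [e]
      exact add_mem (hp l) hB
  refine ⟨?_, add_mem h2 (h1 3), ?_⟩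
  · intro i
    fin_cases i
    · exact h1 0
    · exact h1 1
    · exact hG.1
    · exact add_mem (add_mem (h1 3) hG.1) hs'
  · intro i
    by_cases hij : i = j
    · subst hij
      refine ⟨fun h => by omega, fun _ l => ?_⟩
      have hif : (if l = 0 then x.1 3 else 0) ∈ ZQ := by
        split_ifs
        · exact h1 3
        · exact zero_mem _
      convert add_mem (hG.2 l) hif using 1
      simp [bl, tInv]; ring
    · have hb : bl (tInv j x) i = bl x i := by
        ext l; simp [bl, tInv, hij]
      have : (i : ℕ) ≠ j := fun h => hij (Fin.ext h)
      rw [hb]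
      exact ⟨fun h => (h3 i).1 (by omega), fun h => (h3 i).2 (by omega)⟩

theorem exists_G (m : ℕ) (hm : m ≤ k) : ∃ G : Amb (Ix k) ≃ₗ[ℚ] Amb (Ix k),
    (∀ x y, BA (G x) (G y) = BA x y) ∧ ∀ x, G x ∈ SL k 0 ↔ x ∈ SL k m := by
  induction m with
  | zero => exact ⟨LinearEquiv.refl _ _, fun _ _ => rfl, fun _ => Iff.rfl⟩
  | succ m ih =>
    obtain ⟨G, h1, h2⟩ := ih (by omega)
    let j : Fin k := ⟨m, by omega⟩
    let T : Amb (Ix k) ≃ₗ[ℚ] Amb (Ix k) := LinearEquiv.ofLinear (tInv j) (tMap j)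
      (LinearMap.ext (tInv_tMap j)) (LinearMap.ext (tMap_tInv j))
    have hT : ∀ x, T x = tInv j x := fun x => rfl
    refine ⟨T.trans G, ?_, ?_⟩
    · intro x y
      rw [LinearEquiv.trans_apply, LinearEquiv.trans_apply, h1, hT, hT,
        ← tMap_iso j, tMap_tInv, tMap_tInv]
    · intro x
      rw [LinearEquiv.trans_apply, h2, hT]
      refine ⟨fun h => ?_, fun h => tInv_mem j x h⟩
      have := tMap_mem j _ h
      rwa [tMap_tInv] at this

theorem InE.even {y : Fin 8 → ℚ} (h : InE y) : (∑ l, y l * y l) / 2 ∈ ZQ := by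
  obtain ⟨h1 | h1, h2⟩ := h
  · exact half_dot y h1 h2
  · have : (∑ l, y l * y l) / 2 = ∑ l, (((y l - 1 / 2) * (y l - 1 / 2) - (y l - 1 / 2)) / 2
        + (y l - 1 / 2)) + 1 := by
      simp [Fin.sum_univ_eight]; ring
    rw [this]
    exact add_mem (sum_mem fun l _ => add_mem (half_sq_add _ (h1 l)) (h1 l)) (one_mem _)

theorem U_even (u : Fin 4 → ℚ) (h : ∀ i, u i ∈ ZQ) : UForm u u / 2 ∈ ZQ := by
  convert add_mem (mul_mem (h 0) (h 1)) (mul_mem (h 2) (h 3)) using 1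
  rw [UForm]; ring

theorem LA_iff (x : Amb (Ix k)) : x ∈ LA (Ix k) ↔ x ∈ SL k 0 ∧ BA x x / 2 ∈ ZQ := by
  have hS : x ∈ SL k 0 ↔ (∀ i, x.1 i ∈ ZQ) ∧ ∀ i, x.2 i ∈ ZQ := by
    constructor
    · rintro ⟨h1, h2, h3⟩
      refine ⟨h1, ?_⟩
      rintro (_ | ⟨i, l⟩)
      · exact h2
      · exact (h3 i).2 (Nat.zero_le _) l
    · rintro ⟨h1, h2⟩
      exact ⟨h1, h2 none, fun i => ⟨fun h => absurd h (Nat.not_lt_zero _), fun _ l => h2 _⟩⟩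
  rw [hS]
  constructor
  · rintro ⟨h1, h2, h3⟩
    refine ⟨⟨h1, h2⟩, ?_⟩
    rw [BA, sub_div]
    exact sub_mem (U_even _ h1) (half_dot _ h2 h3)
  · rintro ⟨⟨h1, h2⟩, h3⟩
    refine ⟨h1, h2, ?_⟩
    convert sub_mem (sub_mem (U_even _ h1) h3) (half_dot_sub _ h2) using 1
    rw [BA]; ring

theorem SLk_even (x : Amb (Ix k)) (hx : x ∈ SL k k) :
    BA x x / 2 ∈ ZQ ↔ (x.2 none * x.2 none) / 2 ∈ ZQ := by
  obtain ⟨h1, h2, h3⟩ := hx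
  have e : BA x x / 2 = UForm x.1 x.1 / 2 - x.2 none * x.2 none / 2
      - ∑ i, (∑ l, bl x i l * bl x i l) / 2 := by
    rw [BA, dotProduct, Fintype.sum_option, Fintype.sum_prod_type, ← Finset.sum_div]
    simp only [bl]; ring
  have hs : ∑ i, (∑ l, bl x i l * bl x i l) / 2 ∈ ZQ :=
    sum_mem fun i _ => ((h3 i).1 i.2).even
  have hu := U_even _ h1
  constructor
  · intro h
    convert sub_mem (sub_mem hu hs) h using 1
    rw [e]; ring
  · intro h
    rw [e]
    exact sub_mem (sub_mem hu h) hs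

theorem half_of_sq (t : ℚ) (h : t ∈ ZQ) (h2 : t * t / 2 ∈ ZQ) : t / 2 ∈ ZQ := by
  convert sub_mem h2 (half_sq_add t h) using 1
  ring

/-- Embedding of the ambient space of `II`. -/
def emb (k : ℕ) : IIAmb k →ₗ[ℚ] Amb (Ix k) where
  toFun x := (x.1, fun o => Option.elim o 0 fun p => x.2 p.1 p.2)
  map_add' x y := by
    ext i
    · simp
    · rcases i with _ | ⟨i, l⟩ <;> simp
  map_smul' c x := by
    ext i
    · simp
    · rcases i with _ | ⟨i, l⟩ <;> simp

theorem E8_iff (y : Fin 8 → ℚ) : y ∈ E8Set ↔ InE y := by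
  have h2 : (∃ a : ℤ, (∑ i, y i) = 2 * (a : ℚ)) ↔ (∑ i, y i) / 2 ∈ ZQ := by
    rw [mem_ZQ]
    refine exists_congr fun a => ?_
    constructor <;> intro h <;> linarith
  simp only [E8Set, Set.mem_setOf_eq, IntVec, InE, ← h2, mem_ZQ, halfVec, Pi.sub_apply]

theorem emb_mem (x : IIAmb k) : emb k x ∈ SL k k ↔ x ∈ IISet k := by
  constructor
  · rintro ⟨h1, h2, h3⟩
    exact ⟨fun i => mem_ZQ.1 (h1 i), fun j => (E8_iff _).2 ((h3 j).1 j.2)⟩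
  · rintro ⟨h1, h2⟩
    exact ⟨fun i => mem_ZQ.2 (h1 i), zero_mem _, fun j => ⟨fun _ => (E8_iff _).1 (h2 j),
      fun h => absurd j.2 (by omega)⟩⟩

theorem emb_form (x y : IIAmb k) : BA (emb k x) (emb k y) = IIForm k x y := by
  rw [BA, IIForm, dotProduct, Fintype.sum_option, Fintype.sum_prod_type]
  simp [emb, negE, sub_eq_add_neg]

theorem emb_inj : Function.Injective (emb k) := by
  intro x y h
  ext i
  · exact congrFun (congrArg Prod.fst h) i
  · rename_i l
    exact congrFun (congrArg Prod.snd h) (some (i, l))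

theorem main_A (v : Amb (Ix k)) (hn : BA v v = -4) (hd : ∀ x ∈ LA (Ix k), BA v x / 4 ∈ ZQ) :
    ∃ F : IIAmb k →ₗ[ℚ] Amb (Ix k), Function.Injective F ∧
      (∀ x y, BA (F x) (F y) = IIForm k x y) ∧
      F '' IISet k = {x | x ∈ LA (Ix k) ∧ BA x v = 0} := by
  obtain ⟨G, hG1, hG2⟩ := exists_G (k := k) k le_rfl
  let ε : Amb (Ix k) := (0, Pi.single none 2)
  have hε : ∀ y, BA y ε = -(y.2 none * 2) := by
    intro y; simp [BA, UForm, ε]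
  have hε' : ∀ y, BA ε y = -(2 * y.2 none) := by
    intro y; simp [BA, UForm, ε]
  have hLG : ∀ y, G y ∈ LA (Ix k) ↔ y ∈ SL k k ∧ (y.2 none * y.2 none) / 2 ∈ ZQ := by
    intro y
    rw [LA_iff, hG2, hG1]
    constructor
    · rintro ⟨h1, h2⟩
      exact ⟨h1, (SLk_even y h1).1 h2⟩
    · rintro ⟨h1, h2⟩
      exact ⟨h1, (SLk_even y h1).2 h2⟩
  obtain ⟨g, hg, hgv⟩ := eqv_of_div (G ε) v (by
      rw [hG1, hε]; simp [ε]; norm_num) (by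
      intro x hx
      obtain ⟨y, rfl⟩ := G.surjective x
      obtain ⟨h1, h2⟩ := (hLG y).1 hx
      rw [hG1, hε']
      convert neg_mem (half_of_sq _ h1.2.1 h2) using 1
      ring) hn hd
  refine ⟨(g.toLinearMap ∘ₗ G.toLinearMap) ∘ₗ emb k, ?_, ?_, ?_⟩
  · intro x y h
    exact emb_inj (G.injective (g.injective h))
  · intro x y
    simp only [LinearMap.comp_apply, LinearEquiv.coe_coe]
    rw [hg.1, hG1, emb_form]
  · ext x
    constructor
    · rintro ⟨y, hy, rfl⟩
      simp only [LinearMap.comp_apply, LinearEquiv.coe_coe, Set.mem_setOf_eq]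
      rw [hg.2, hLG, ← hgv, hg.1, hG1, hε, emb_mem]
      have : (emb k y).2 none = 0 := rfl
      rw [this]
      exact ⟨⟨hy, by simpa using zero_mem ZQ⟩, by simp⟩
    · rintro ⟨h1, h2⟩
      obtain ⟨x, rfl⟩ := g.surjective x
      obtain ⟨y, rfl⟩ := G.surjective x
      rw [← hgv, hg.1, hG1, hε] at h2
      rw [hg.2, hLG] at h1
      have hy0 : y.2 none = 0 := by linarith
      have hy : emb k (y.1, fun i l => y.2 (some (i, l))) = y := by
        ext i
        · rfl
        · rcases i with _ | ⟨i, l⟩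
          · exact hy0.symm
          · rfl
      refine ⟨(y.1, fun i l => y.2 (some (i, l))), ?_, ?_⟩
      · rw [← emb_mem, hy]; exact h1.1
      · simp only [LinearMap.comp_apply, LinearEquiv.coe_coe, hy]

end blocks

section final

/-- Index map. -/
def ixFun (k : ℕ) : Fin 4 ⊕ Ix k → Fin (8 * k + 3 + 2)
  | Sum.inl i => ⟨i, by omega⟩
  | Sum.inr none => ⟨4, by omega⟩
  | Sum.inr (some (j, l)) => ⟨5 + 8 * j + l, by omega⟩

theorem ixFun_bij (k : ℕ) : Function.Bijective (ixFun k) := by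
  rw [Fintype.bijective_iff_injective_and_card]
  constructor
  · rintro (i | _ | ⟨j, l⟩) (i' | _ | ⟨j', l'⟩) h <;>
      simp only [ixFun, Fin.mk.injEq] at h
    · exact congrArg _ (Fin.ext h)
    · omega
    · omega
    · omega
    · rfl
    · omega
    · omega
    · omega
    · have h1 : j = j' := Fin.ext (by omega)
      have h2 : l = l' := Fin.ext (by omega)
      rw [h1, h2]
  · simp; omega

/-- Index equivalence. -/
def ixE (k : ℕ) : Fin 4 ⊕ Ix k ≃ Fin (8 * k + 3 + 2) := Equiv.ofBijective _ (ixFun_bij k)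

/-- Change of coordinates. -/
def Psi (k : ℕ) : (Fin (8 * k + 3 + 2) → ℚ) ≃ₗ[ℚ] Amb (Ix k) where
  toFun y := (fun i => y (ixE k (Sum.inl i)), fun o => y (ixE k (Sum.inr o)))
  invFun x := fun n => Sum.elim x.1 x.2 ((ixE k).symm n)
  map_add' x y := rfl
  map_smul' c x := rfl
  left_inv y := by
    ext n
    obtain ⟨m, rfl⟩ := (ixE k).surjective n
    rcases m with m | m <;> simp
  right_inv x := by
    ext n <;> simp

theorem sum_four (k : ℕ) (f : Fin (8 * k + 3 + 2) → ℚ) :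
    (∑ i : Fin (8 * k + 3 + 2), if 4 ≤ (i : ℕ) then f i else 0)
      = ∑ o, f (ixE k (Sum.inr o)) := by
  rw [← (ixE k).sum_comp, Fintype.sum_sum_type]
  have h1 : ∀ i : Fin 4, ¬ 4 ≤ ((ixE k (Sum.inl i) : Fin _) : ℕ) := by
    intro i
    simp only [ixE, Equiv.ofBijective_apply, ixFun]
    omega
  have h2 : ∀ o, 4 ≤ ((ixE k (Sum.inr o) : Fin _) : ℕ) := by
    rintro (_ | ⟨j, l⟩) <;> simp only [ixE, Equiv.ofBijective_apply, ixFun] <;> omega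
  simp [h1, h2]

theorem Psi_form (k : ℕ) (x y : Fin (8 * k + 3 + 2) → ℚ) :
    LamForm (8 * k + 3) x y = BA (Psi k x) (Psi k y) := by
  have e0 : ixE k (Sum.inl 0) = 0 := Fin.ext rfl
  have e1 : ixE k (Sum.inl 1) = 1 := Fin.ext rfl
  have e2 : ixE k (Sum.inl 2) = 2 := Fin.ext (Nat.mod_eq_of_lt (by omega)).symm
  have e3 : ixE k (Sum.inl 3) = 3 := Fin.ext (Nat.mod_eq_of_lt (by omega)).symm
  rw [LamForm, sum_four k (fun i => x i * y i)]
  simp only [BA, UForm, Psi, LinearEquiv.coe_mk, LinearMap.coe_mk, AddHom.coe_mk, e0, e1, e2, e3,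
    dotProduct]

theorem Psi_mem (k : ℕ) (x : Fin (8 * k + 3 + 2) → ℚ) :
    Psi k x ∈ LA (Ix k) ↔ x ∈ LamSet (8 * k + 3) := by
  have h2 : (∃ a : ℤ, (∑ o, x (ixE k (Sum.inr o))) = 2 * (a : ℚ)) ↔
      (∑ o, x (ixE k (Sum.inr o))) / 2 ∈ ZQ := by
    rw [mem_ZQ]
    refine exists_congr fun a => ?_
    constructor <;> intro h <;> linarith
  rw [LamSet, Set.mem_setOf_eq, sum_four k x, h2]
  constructor
  · rintro ⟨h1, h2, h3⟩
    refine ⟨fun n => ?_, h3⟩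
    obtain ⟨m, rfl⟩ := (ixE k).surjective n
    rcases m with m | m
    · exact mem_ZQ.1 (h1 m)
    · exact mem_ZQ.1 (h2 m)
  · rintro ⟨h1, h3⟩
    exact ⟨fun i => mem_ZQ.2 (h1 _), fun i => mem_ZQ.2 (h1 _), h3⟩

theorem LA_add_zsmul {ι : Type} [Fintype ι] (x v : Amb ι) (hx : x ∈ LA ι) (hv : v ∈ LA ι)
    (b : ℤ) : x + (b : ℚ) • v ∈ LA ι := by
  refine ⟨fun i => add_mem (hx.1 i) (mul_mem (int_mem_ZQ b) (hv.1 i)),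
    fun i => add_mem (hx.2.1 i) (mul_mem (int_mem_ZQ b) (hv.2.1 i)), ?_⟩
  convert add_mem hx.2.2 (mul_mem (int_mem_ZQ b) hv.2.2) using 1
  simp [Finset.sum_add_distrib, ← Finset.mul_sum]; ring

end final

/-- Let `(Λ, ξ)` be a decorated `D`-lattice of dimension `N = 8k + 3`, and let `v` be a
unigonal vector (`v² = -4`, `div(v) = 4`).  Then `Λ = ⟨v⟩ ⊕ v^⊥` and `v^⊥` is
isomorphic, as a lattice, to the even unimodular lattice `II_{2,2+8k} = U² ⊕ E₈^k`. -/
theorem statement9 (N : ℕ) (hN : 3 ≤ N) (hmod : N % 8 = 3)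
    (v : Fin (N + 2) → ℚ) (hv : v ∈ LamSet N)
    (hv2 : LamForm N v v = -4)
    (hdiv : HasDiv N v 4) :
    (∀ x ∈ LamSet N, ∃ a : ℤ, ∃ y, y ∈ LamSet N ∧ LamForm N y v = 0 ∧
      x = (a : ℚ) • v + y) ∧
    ∃ F : IIAmb (N / 8) →ₗ[ℚ] (Fin (N + 2) → ℚ),
      Function.Injective F ∧
      (∀ x y, LamForm N (F x) (F y) = IIForm (N / 8) x y) ∧
      F '' IISet (N / 8) = {x | x ∈ LamSet N ∧ LamForm N x v = 0} := by
  generalize hk : N / 8 = k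
  have hNk : N = 8 * k + 3 := by omega
  subst hNk
  have hd : ∀ x ∈ LA (Ix k), BA (Psi k v) x / 4 ∈ ZQ := by
    intro x hx
    obtain ⟨y, rfl⟩ := (Psi k).surjective x
    obtain ⟨a, ha⟩ := hdiv.1 y ((Psi_mem k y).1 hx)
    rw [← Psi_form, ha]
    refine mem_ZQ.2 ⟨a, ?_⟩
    push_cast; ring
  constructor
  · intro x hx
    obtain ⟨b, hb⟩ := hdiv.1 x hx
    refine ⟨-b, x + (b : ℚ) • v, ?_, ?_, ?_⟩
    · rw [← Psi_mem, map_add, map_smul]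
      exact LA_add_zsmul _ _ ((Psi_mem k x).2 hx) ((Psi_mem k v).2 hv) b
    · rw [Psi_form] at hb hv2 ⊢
      have : BA (Psi k (x + (b : ℚ) • v)) (Psi k v)
          = BA (Psi k v) (Psi k x) + b * BA (Psi k v) (Psi k v) := by
        rw [map_add, map_smul]
        simp [BA, UForm]
        rw [dotProduct_comm (Psi k x).2]
        ring
      rw [this, hb, hv2]
      push_cast; ring
    · push_cast
      rw [neg_smul]
      abel
  · obtain ⟨F, h1, h2, h3⟩ := main_A (Psi k v) (by rw [← Psi_form, hv2]) hd
    refine ⟨(Psi k).symm.toLinearMap ∘ₗ F, ?_, ?_, ?_⟩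
    · intro x y h
      exact h1 ((Psi k).symm.injective h)
    · intro x y
      rw [Psi_form]
      simp [h2]
    · ext x
      rw [Set.mem_setOf_eq, ← Psi_mem, Psi_form]
      have : Psi k x ∈ F '' IISet k ↔ Psi k x ∈ LA (Ix k) ∧ BA (Psi k x) (Psi k v) = 0 := by
        rw [h3]; rfl
      rw [← this]
      simp only [Set.mem_image, LinearMap.comp_apply, LinearEquiv.coe_coe,
        LinearEquiv.symm_apply_eq]
end
end
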